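/- arXiv:2003.08053 — 2 statements merged into one kernel-verified Lean document; each statement's English description precedes it below -/
import Mathlib

section
/- Let Γ be a commutative thick weakly distance-regular digraph. If p^{(2,q-2)}_{(1,p-1),(1,q-1)} ≠ 0 with q ≠ p, then the configuration C(q) exists and p = q-1. -/
/-!
Common framework: commutative thick weakly distance-regular digraphs.
-/

variable {V : Type*}

/-- There is a directed walk of length `n` from `x` to `y`. -/
def HasWalk (adj : V → V → Prop) (x y : V) (n : ℕ) : Prop :=
  ∃ f : ℕ → V, f 0 = x ∧ f n = y ∧ ∀ i < n, adj (f i) (f (i + 1))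

/-- Directed distance `∂(x,y)`. -/
noncomputable def ddist (adj : V → V → Prop) (x y : V) : ℕ :=
  sInf {n | HasWalk adj x y n}

/-- Two-way distance `∂̃(x,y) = (∂(x,y), ∂(y,x))`. -/
noncomputable def tdist (adj : V → V → Prop) (x y : V) : ℕ × ℕ :=
  (ddist adj x y, ddist adj y x)

/-- The pair `i` is an attained two-way distance, i.e. `i ∈ ∂̃(Γ)`. -/
def Attained (adj : V → V → Prop) (i : ℕ × ℕ) : Prop :=
  ∃ x y : V, tdist adj x y = i

/-- Intersection number `p^h_{i,j}`: for attained `h` it is the common cardinality of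
`{z | ∂̃(x,z) = i, ∂̃(z,y) = j}` over pairs with `∂̃(x,y) = h` (and `0` otherwise). -/
noncomputable def pnum (adj : V → V → Prop) (h i j : ℕ × ℕ) : ℕ :=
  sSup {n | ∃ x y : V, tdist adj x y = h ∧
    n = Set.ncard {z : V | tdist adj x z = i ∧ tdist adj z y = j}}

/-- Valency `k_i = |Γ_i(x)|`. -/
noncomputable def kval (adj : V → V → Prop) (i : ℕ × ℕ) : ℕ :=
  pnum adj (0, 0) i i.swap

/-- Adjacency of the subdigraph `Δ_J`: arcs of type `(1, t-1)` for `t ∈ J`. -/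
def deltaAdj (adj : V → V → Prop) (J : Set ℕ) (u v : V) : Prop :=
  ∃ t ∈ J, tdist adj u v = (1, t - 1)

/-- A circuit of length `s`. -/
def IsCircuit (adj : V → V → Prop) (s : ℕ) (f : ℕ → V) : Prop :=
  0 < s ∧ f s = f 0 ∧ ∀ i < s, adj (f i) (f (i + 1))

/-- Strongly connected. -/
def IsStrong (adj : V → V → Prop) : Prop :=
  ∀ x y : V, ∃ n, HasWalk adj x y n

/-- Weakly distance-regular: the intersection numbers are well defined. -/
def IsWDR (adj : V → V → Prop) : Prop :=
  ∀ (i j : ℕ × ℕ) (x y x' y' : V), tdist adj x y = tdist adj x' y' →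
    Set.ncard {z : V | tdist adj x z = i ∧ tdist adj z y = j}
      = Set.ncard {z : V | tdist adj x' z = i ∧ tdist adj z y' = j}

/-- Thick: `p^h_{i,i}, p^h_{i,i*} ∈ {0, k_i}`. -/
def IsThick (adj : V → V → Prop) : Prop :=
  ∀ h i : ℕ × ℕ,
    (pnum adj h i i = 0 ∨ pnum adj h i i = kval adj i) ∧
    (pnum adj h i i.swap = 0 ∨ pnum adj h i i.swap = kval adj i)

/-- A thick weakly distance-regular digraph (as a property of an adjacency relation). -/
def IsWDRThick (adj : V → V → Prop) : Prop :=
  IsStrong adj ∧ IsWDR adj ∧ IsThick adj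

/-- A commutative thick weakly distance-regular digraph. -/
structure CTWDR (V : Type*) [Fintype V] where
  adj : V → V → Prop
  loopless : ∀ v, ¬ adj v v
  strong : IsStrong adj
  wdr : IsWDR adj
  comm : ∀ (i j : ℕ × ℕ) (x y : V),
    Set.ncard {z : V | tdist adj x z = i ∧ tdist adj z y = j}
      = Set.ncard {z : V | tdist adj x z = j ∧ tdist adj z y = i}
  thick : IsThick adj

namespace CTWDR

variable {V : Type*} [Fintype V] (G : CTWDR V)

/-- Product `EF` of two sets of relations (relations identified with two-way distances). -/
def prodS (E F : Set (ℕ × ℕ)) : Set (ℕ × ℕ) :=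
  {h | ∃ i ∈ E, ∃ j ∈ F, pnum G.adj h i j ≠ 0}

/-- Powers `Γ_i^l` (with `Γ_i^0 = {Γ_{(0,0)}}` and `Γ_i^1 = {Γ_i}`). -/
def pow (i : ℕ × ℕ) : ℕ → Set (ℕ × ℕ)
  | 0 => {(0, 0)}
  | 1 => {i}
  | n + 2 => G.prodS (pow i (n + 1)) {i}

/-- The pair `(1, s-1)` is pure: every circuit of length `s` containing an arc of type
`(1, s-1)` consists of arcs of type `(1, s-1)`. -/
def Pure (s : ℕ) : Prop :=
  ∀ f : ℕ → V, IsCircuit G.adj s f →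
    (∃ i < s, tdist G.adj (f i) (f (i + 1)) = (1, s - 1)) →
    ∀ i < s, tdist G.adj (f i) (f (i + 1)) = (1, s - 1)

/-- `(1, s-1)` is mixed. -/
def Mixed (s : ℕ) : Prop := ¬ G.Pure s

/-- Configuration `C(q)` exists. -/
def Cexists (q : ℕ) : Prop :=
  pnum G.adj (1, q - 2) (1, q - 1) (1, q - 1) ≠ 0 ∧ G.Pure (q - 1)

/-- Configuration `D(q)` exists. -/
def Dexists (q : ℕ) : Prop :=
  pnum G.adj (1, q - 1) (1, q - 2) (q - 2, 1) ≠ 0 ∧ G.Pure (q - 1)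

/-- A closed set of relations: `Γ_{i*}Γ_j ⊆ F` for all `i, j ∈ F`. -/
def Closed (F : Set (ℕ × ℕ)) : Prop :=
  ∀ i ∈ F, ∀ j ∈ F, G.prodS {i.swap} {j} ⊆ F

/-- The minimal closed set `⟨F⟩` containing `F`. -/
def genClosed (F : Set (ℕ × ℕ)) : Set (ℕ × ℕ) :=
  ⋂₀ {C | F ⊆ C ∧ G.Closed C}

/-- The block `F_J(x)` of the closed set generated by `{Γ_{1,t-1}}_{t ∈ J}`. -/
def block (J : Set ℕ) (x : V) : Set V :=
  {y | tdist G.adj x y ∈ G.genClosed {i | ∃ t ∈ J, i = (1, t - 1)}}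

end CTWDR

set_option linter.unusedSectionVars false

class Hy (T : Type*) where
  m : T → T → T → Prop
  star : T → T
  e0 : T
  ln : T → ℕ
  m_comm : ∀ i j h, m i j h → m j i h
  m_assoc : ∀ i j k g h, m i j g → m g k h → ∃ g', m j k g' ∧ m i g' h
  m_one : ∀ i h, m e0 i h ↔ h = i
  m_inv : ∀ i j h, m i j h → m (star i) h j
  m_star : ∀ i j h, m i j h → m (star i) (star j) (star h)
  star_star : ∀ i, star (star i) = i
  m_e0 : ∀ i, m i (star i) e0
  m_e0' : ∀ i j, m i j e0 → j = star i
  m_ne : ∀ i j, ∃ h, m i j h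
  thick : ∀ i k h, m i (star i) k → m k i h → h = i
  ln_inj : ∀ i j, ln i = ln j → ln (star i) = ln (star j) → i = j
  ln_zero : ∀ i, ln i = 0 ↔ i = e0
  ln_tri : ∀ i j h, m i j h → ln h ≤ ln i + ln j
  ln_path : ∀ i n, ln i = n + 1 → ∃ e j, ln e = 1 ∧ ln j = n ∧ m e j i

namespace Hy

def CS (T : Type*) := Set T

variable {T : Type*} [Hy T]

instance : Membership T (CS T) := ⟨fun A x => A x⟩

theorem CS.ext {A B : CS T} (h : ∀ x, x ∈ A ↔ x ∈ B) : A = B :=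
  funext fun x => propext (h x)

instance : Mul (CS T) := ⟨fun A B => fun h => ∃ i, i ∈ A ∧ ∃ j, j ∈ B ∧ m i j h⟩
instance : Add (CS T) := ⟨fun A B => fun h => h ∈ A ∨ h ∈ B⟩
instance : Zero (CS T) := ⟨fun _ => False⟩
instance : One (CS T) := ⟨fun h => h = e0⟩

theorem mem_mul {A B : CS T} {h : T} : h ∈ A * B ↔ ∃ i, i ∈ A ∧ ∃ j, j ∈ B ∧ m i j h := Iff.rfl
theorem mem_add {A B : CS T} {h : T} : h ∈ A + B ↔ h ∈ A ∨ h ∈ B := Iff.rfl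
theorem mem_zero {h : T} : h ∈ (0 : CS T) ↔ False := Iff.rfl
theorem mem_one {h : T} : h ∈ (1 : CS T) ↔ h = e0 := Iff.rfl

theorem cmul_comm (A B : CS T) : A * B = B * A := by
  apply CS.ext; intro x; constructor <;> rintro ⟨i, hi, j, hj, h⟩ <;>
    exact ⟨j, hj, i, hi, m_comm _ _ _ h⟩

theorem cmul_assoc' (A B C : CS T) (x : T) (hx : x ∈ A * B * C) : x ∈ A * (B * C) := by
  obtain ⟨g, ⟨i, hi, j, hj, h⟩, k, hk, h'⟩ := hx
  obtain ⟨g', h1, h2⟩ := m_assoc _ _ _ _ _ h h'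
  exact ⟨i, hi, g', ⟨j, hj, k, hk, h1⟩, h2⟩

theorem cmul_assoc (A B C : CS T) : A * B * C = A * (B * C) := by
  apply CS.ext; intro x
  refine ⟨cmul_assoc' A B C x, fun hx => ?_⟩
  rw [cmul_comm A, cmul_comm B] at hx
  have := cmul_assoc' _ _ _ _ hx
  rwa [cmul_comm, cmul_comm A]

theorem cone_mul (A : CS T) : 1 * A = A := by
  apply CS.ext; intro x; constructor
  · rintro ⟨i, hi, j, hj, h⟩
    rw [mem_one] at hi; subst hi
    rw [m_one] at h; subst h; exact hj
  · intro hx; exact ⟨e0, rfl, x, hx, (m_one _ _).2 rfl⟩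

theorem cleft_distrib (A B C : CS T) : A * (B + C) = A * B + A * C := by
  apply CS.ext; intro x; simp only [mem_mul, mem_add]; grind

instance : CommSemiring (CS T) where
  add_assoc := by intros; apply CS.ext; intro x; simp only [mem_add]; tauto
  zero_add := by intros; apply CS.ext; intro x; simp only [mem_add, mem_zero]; tauto
  add_zero := by intros; apply CS.ext; intro x; simp only [mem_add, mem_zero]; tauto
  add_comm := by intros; apply CS.ext; intro x; simp only [mem_add]; tauto
  nsmul := nsmulRec
  mul_assoc := cmul_assoc
  mul_comm := cmul_comm
  one_mul := cone_mul
  mul_one := fun A => by rw [cmul_comm, cone_mul]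
  left_distrib := cleft_distrib
  right_distrib := fun A B C => by
    rw [cmul_comm, cleft_distrib, cmul_comm C A, cmul_comm C B]
  zero_mul := by intros; apply CS.ext; intro x; simp only [mem_mul, mem_zero]; grind
  mul_zero := by intros; apply CS.ext; intro x; simp only [mem_mul, mem_zero]; grind

def S (x : T) : CS T := fun y => y = x

theorem mem_S {x y : T} : y ∈ S x ↔ y = x := Iff.rfl
theorem S_self (x : T) : x ∈ S x := rfl

instance : HasSubset (CS T) := ⟨fun A B => ∀ x, x ∈ A → x ∈ B⟩

theorem sub_refl (A : CS T) : A ⊆ A := fun _ h => h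
theorem sub_antisymm {A B : CS T} (h : A ⊆ B) (h' : B ⊆ A) : A = B :=
  CS.ext fun x => ⟨h x, h' x⟩
theorem sub_trans {A B C : CS T} (h : A ⊆ B) (h' : B ⊆ C) : A ⊆ C := fun x hx => h' x (h x hx)
theorem mul_sub {A B C D : CS T} (h : A ⊆ C) (h' : B ⊆ D) : A * B ⊆ C * D := by
  rintro x ⟨i, hi, j, hj, hx⟩; exact ⟨i, h i hi, j, h' j hj, hx⟩
theorem mul_subl {A C : CS T} (h : A ⊆ C) (B : CS T) : A * B ⊆ C * B := mul_sub h (sub_refl B)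
theorem mul_subr {A C : CS T} (B : CS T) (h : A ⊆ C) : B * A ⊆ B * C := mul_sub (sub_refl B) h
theorem pow_sub {A B : CS T} (h : A ⊆ B) (n : ℕ) : A ^ n ⊆ B ^ n := by
  induction n with
  | zero => rw [pow_zero, pow_zero]; exact sub_refl _
  | succ n ih => rw [pow_succ, pow_succ]; exact mul_sub ih h
theorem S_sub {x : T} {A : CS T} (h : x ∈ A) : S x ⊆ A := by
  intro y hy; rw [mem_S] at hy; rwa [hy]
theorem one_sub {A : CS T} (h : e0 ∈ A) : (1 : CS T) ⊆ A := by
  intro y hy; rw [mem_one] at hy; rwa [hy]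
theorem mem_mul_of {x y h : T} {A B : CS T} (hx : x ∈ A) (hy : y ∈ B) (hm : m x y h) : h ∈ A * B :=
  ⟨x, hx, y, hy, hm⟩
theorem one_eq : (1 : CS T) = S e0 := rfl

theorem SS_sub {x y : T} : (x ∈ S (T := T) y) = (x = y) := rfl

theorem split {A B : CS T} (h : e0 ∈ A * B) : ∃ g, g ∈ A ∧ e0 ∈ S g * B := by
  obtain ⟨i, hi, j, hj, h⟩ := h
  exact ⟨i, hi, i, rfl, j, hj, h⟩

theorem split' {x : T} {A B : CS T} (h : x ∈ A * B) : ∃ g, g ∈ A ∧ x ∈ S g * B := by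
  obtain ⟨i, hi, j, hj, h⟩ := h
  exact ⟨i, hi, i, rfl, j, hj, h⟩

theorem e0_S {x : T} {B : CS T} : e0 ∈ S x * B ↔ star x ∈ B := by
  constructor
  · rintro ⟨i, hi, j, hj, h⟩
    rw [mem_S] at hi; subst hi
    have := m_e0' _ _ h; rwa [this] at hj
  · intro h; exact ⟨x, rfl, _, h, m_e0 x⟩

theorem mem_iff {x : T} {A : CS T} : x ∈ A ↔ e0 ∈ A * S (star x) := by
  rw [mul_comm, e0_S, star_star]

theorem e0_star (x : T) : e0 ∈ S x * S (star x) := e0_S.2 rfl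

theorem thickS (t : T) : S t * S (star t) * S t = S t := by
  apply sub_antisymm
  · rintro x ⟨i, ⟨a, ha, b, hb, h1⟩, j, hj, h⟩
    rw [mem_S] at ha hb hj; subst ha hb hj
    exact thick _ _ _ h1 h
  · have := mul_subl (one_sub (e0_star t)) (S t)
    rwa [one_mul] at this

theorem inv_mem {a b h : T} (hh : h ∈ S a * S b) : b ∈ S (star a) * S h := by
  obtain ⟨i, hi, j, hj, hm⟩ := hh
  rw [mem_S] at hi hj; subst hi hj
  exact ⟨_, rfl, _, rfl, m_inv _ _ _ hm⟩

theorem mul_sub_of {a b h : T} (hh : h ∈ S a * S b) : S a * S b ⊆ S a * S (star a) * S h := by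
  rw [mul_assoc]; exact mul_subr _ (S_sub (inv_mem hh))

/-- coset equality -/
theorem L1 {a b s h : T} (h1 : h ∈ S a * S b) (h2 : h ∈ S a * S s) : S a * S b = S a * S s := by
  have key : ∀ {b s : T}, h ∈ S a * S b → h ∈ S a * S s → S a * S b ⊆ S a * S s := by
    intro b s h1 h2
    have h3 := mul_subr (S a * S (star a)) (S_sub h2)
    rw [← mul_assoc, thickS] at h3
    exact sub_trans (mul_sub_of h1) h3
  exact sub_antisymm (key h1 h2) (key h2 h1)

theorem R {v x y : T} (h : v ∈ S x * S y) : S x * S y * S x = S v * S x := by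
  apply sub_antisymm
  · have := mul_subl (mul_sub_of h) (S x)
    rwa [show S x * S (star x) * S v * S x = S v * (S x * S (star x) * S x) by ring, thickS] at this
  · exact mul_subl (S_sub h) _

theorem K1 {x t : T} (h : t ∈ S x * S t) : S x * S t = S t := by
  apply sub_antisymm
  · rw [mul_comm] at h
    have h2 := mul_subl (S_sub (inv_mem h)) (S t)
    rwa [show S (star t) * S t * S t = S t * S (star t) * S t by ring, thickS] at h2
  · exact S_sub h

theorem powT (t : T) (n : ℕ) : S t ^ n * S (star t) ^ n * S t = S t := by
  induction n with
  | zero => simp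
  | succ n ih =>
    rw [show S t ^ (n+1) * S (star t) ^ (n+1) * S t
      = (S t ^ n * S (star t) ^ n * S t) * (S (star t) * S t) by ring, ih, ← mul_assoc, thickS]

theorem star_e0 : star (e0 : T) = e0 := by
  have := m_e0 (e0 : T); rw [m_one] at this; exact this.symm

theorem star_pow {t x : T} {n : ℕ} (h : x ∈ S t ^ n) : star x ∈ S (star t) ^ n := by
  induction n generalizing x with
  | zero => rw [pow_zero, mem_one] at *; rw [h, star_e0]
  | succ n ih =>
    rw [pow_succ] at *
    obtain ⟨i, hi, j, hj, h⟩ := h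
    rw [mem_S] at hj; subst hj
    exact ⟨_, ih hi, _, rfl, m_star _ _ _ h⟩

theorem P {t : T} {n : ℕ} (h : e0 ∈ S t ^ n) : S t ^ n * S t = S t := by
  apply sub_antisymm
  · have h1 := star_pow h
    rw [star_e0] at h1
    have h2 := mul_subr (S t ^ n * S t) (one_sub h1)
    rwa [mul_one, show S t ^ n * S t * S (star t) ^ n = S t ^ n * S (star t) ^ n * S t by ring,
      powT] at h2
  · have := mul_subl (one_sub h) (S t)
    rwa [one_mul] at this

theorem mem_of_e0 {t : T} {A : CS T} (h : e0 ∈ A) : t ∈ A * S t := by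
  have := mul_subl (one_sub h) (S t)
  rw [one_mul] at this; exact this _ rfl

/-- `t ∈ Y t t` gives `e0 ∈ Y t` -/
theorem cancel {t : T} {Y : CS T} (h : t ∈ Y * S t * S t) : e0 ∈ Y * S t := by
  rw [mem_iff, show Y * S t * S t * S (star t) = Y * (S t * S (star t) * S t) by ring, thickS] at h
  exact h

theorem powK {x t : T} (h : S x * S t = S t) {n : ℕ} (hn : 1 ≤ n) : S x * S t ^ n = S t ^ n := by
  obtain ⟨k, rfl⟩ : ∃ k, n = k + 1 := ⟨n - 1, by omega⟩
  rw [show S x * S t ^ (k+1) = (S x * S t) * S t ^ k by ring, h]; ring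

theorem starK {x t : T} (h : S x * S t = S t) : S (star x) * S t = S t := by
  apply K1
  have : t ∈ S x * S t := by rw [h]; rfl
  exact inv_mem this

def Bd (A : CS T) (n : ℕ) : Prop := ∀ x, x ∈ A → ln x ≤ n
theorem Bd.mul {A B : CS T} {n k : ℕ} (h : Bd A n) (h' : Bd B k) : Bd (A * B) (n + k) := by
  rintro x ⟨i, hi, j, hj, hm⟩
  have := ln_tri _ _ _ hm; have := h i hi; have := h' j hj; omega
theorem bS {x : T} (h : ln x = 1) : Bd (S x) 1 := by
  intro y hy; rw [mem_S] at hy; rw [hy, h]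
theorem bpow {x : T} (h : ln x = 1) (n : ℕ) : Bd (S x ^ n) n := by
  induction n with
  | zero => intro y hy; rw [pow_zero, mem_one] at hy; rw [hy, (ln_zero _).2 rfl]
  | succ n ih => rw [pow_succ]; exact ih.mul (bS h)

def PU (U : Multiset T) : CS T := (U.map S).prod
def Arc (U : Multiset T) : Prop := ∀ v, v ∈ U → ln v = 1
theorem PU_cons (v : T) (U : Multiset T) : PU (v ::ₘ U) = S v * PU U := by simp [PU]
theorem PU_zero : PU (0 : Multiset T) = 1 := by simp [PU]
theorem bPU {U : Multiset T} (h : Arc U) : Bd (PU U) (Multiset.card U) := by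
  induction U using Multiset.induction with
  | empty => intro y hy; rw [PU_zero, mem_one] at hy; rw [hy, (ln_zero _).2 rfl]; simp
  | cons v U ih =>
    rw [PU_cons, Multiset.card_cons, add_comm]
    exact (bS (h v (by simp))).mul (ih fun w hw => h w (by simp [hw]))

theorem word (x : T) : ∃ U : Multiset T, Arc U ∧ Multiset.card U = ln x ∧ x ∈ PU U := by
  generalize hn : ln x = n
  induction n generalizing x with
  | zero =>
    refine ⟨0, by intro v hv; simp at hv, rfl, ?_⟩
    rw [PU_zero, mem_one]; exact (ln_zero _).1 hn
  | succ n ih =>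
    obtain ⟨e, j, he, hj, hm⟩ := ln_path _ _ hn
    obtain ⟨U, hU, hc, hx⟩ := ih j hj
    refine ⟨e ::ₘ U, ?_, by simp [hc], ?_⟩
    · intro v hv; rcases Multiset.mem_cons.1 hv with rfl | hv
      · exact he
      · exact hU v hv
    · rw [PU_cons]; exact ⟨e, rfl, j, hx, hm⟩

/-- closing word -/
theorem wordS (x : T) : ∃ U : Multiset T, Arc U ∧ Multiset.card U = ln (star x) ∧
    e0 ∈ S x * PU U := by
  obtain ⟨U, h1, h2, h3⟩ := word (star x)
  exact ⟨U, h1, h2, e0_S.2 h3⟩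

theorem circ {x : T} {Y : CS T} {n : ℕ} (h : e0 ∈ S x * Y) (hb : Bd Y n) : ln (star x) ≤ n :=
  hb _ (e0_S.1 h)

theorem star_pos {x : T} (h : ln x = 1) : 1 ≤ ln (star x) := by
  by_contra hc
  have h0 : ln (star x) = 0 := by omega
  rw [ln_zero] at h0
  have := star_star x; rw [h0, star_e0] at this
  rw [← this, (ln_zero _).2 rfl] at h; omega

theorem ln_two {g b v : T} (hb : ln b = 1) (hv : ln v = 1) (h : g ∈ S b * S v) : ln g ≤ 2 :=
  ((bS hb).mul (bS hv)) g h

/-- lower bound -/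
theorem lowb {g b v : T} (hv : ln v = 1) (h : g ∈ S b * S v) :
    ln (star b) ≤ ln (star g) + 1 := by
  obtain ⟨U, h1, h2, h3⟩ := wordS g
  have h4 := mul_subl (S_sub h) (PU U) _ h3
  rw [mul_assoc] at h4
  have := circ h4 ((bS hv).mul (bPU h1)); omega

theorem star_of_zero {g : T} (h : ln g = 0) : ln (star g) = 0 := by
  rw [ln_zero] at h; rw [h, star_e0, (ln_zero _).2 rfl]

theorem dich {b v : T} {Y : CS T} {k : ℕ} (hb : ln b = 1) (hk : ln (star b) = k + 1) (hk1 : 1 ≤ k)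
    (hv : ln v = 1) (hY : Bd Y k) (h : e0 ∈ S b * S v * Y) :
    ∃ g, g ∈ S b * S v ∧ e0 ∈ S g * Y ∧ ln (star g) = k ∧ (ln g = 1 ∨ ln g = 2) := by
  obtain ⟨g, hg, h1⟩ := split h
  have h2 := circ h1 hY
  have h3 := lowb hv hg
  have h4 := ln_two hb hv hg
  refine ⟨g, hg, h1, by omega, ?_⟩
  have : ln g ≠ 0 := fun h0 => by have := star_of_zero h0; omega
  omega

theorem repl {b a s : T} {U : Multiset T}
    (h : ∀ v, v ∈ U → S b * S v = S b * S a ∨ S b * S v = S b * S s) :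
    ∃ i j, i + j = Multiset.card U ∧ S b * PU U = S b * S a ^ i * S s ^ j ∧
      ((∃ v, v ∈ U ∧ S b * S v = S b * S s) → S b * S s ≠ S b * S a → 1 ≤ j) := by
  induction U using Multiset.induction with
  | empty => exact ⟨0, 0, by simp, by simp [PU_zero], by simp⟩
  | cons v U ih =>
    obtain ⟨i, j, h1, h2, h3⟩ := ih fun w hw => h w (by simp [hw])
    have e1 : S b * PU (v ::ₘ U) = (S b * S v) * PU U := by rw [PU_cons]; ring
    by_cases hv : S b * S v = S b * S a
    · refine ⟨i + 1, j, by simp; omega, ?_, ?_⟩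
      · rw [e1, hv, show S b * S a * PU U = S a * (S b * PU U) by ring, h2]; ring
      · rintro ⟨w, hw, hw'⟩ hne
        rcases Multiset.mem_cons.1 hw with rfl | hw
        · exact absurd (hw'.symm.trans hv) hne
        · exact h3 ⟨w, hw, hw'⟩ hne
    · have hv' := (h v (by simp)).resolve_left hv
      refine ⟨i, j + 1, by simp; omega, ?_, fun _ _ => by omega⟩
      rw [e1, hv', show S b * S s * PU U = S s * (S b * PU U) by ring, h2]; ring

theorem repl1 {b a : T} {U : Multiset T} (h : ∀ v, v ∈ U → S b * S v = S b * S a) :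
    S b * PU U = S b * S a ^ (Multiset.card U) := by
  obtain ⟨i, j, h1, h2, -⟩ := repl (s := a) fun v hv => Or.inl (h v hv)
  rw [h2, ← h1]; ring

theorem pow_ne (c : T) (n : ℕ) : ∃ g, g ∈ S c ^ n := by
  induction n with
  | zero => exact ⟨e0, by rw [pow_zero, mem_one]⟩
  | succ n ih =>
    obtain ⟨g, hg⟩ := ih
    obtain ⟨h, hh⟩ := m_ne g c
    exact ⟨h, by rw [pow_succ]; exact ⟨g, hg, c, rfl, hh⟩⟩

theorem mul_ne (a b : T) : ∃ g, g ∈ S a * S b := by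
  obtain ⟨h, hh⟩ := m_ne a b
  exact ⟨h, a, rfl, b, rfl, hh⟩

theorem fin_order [Finite T] (c : T) : ∃ n, 1 ≤ n ∧ e0 ∈ S c ^ n := by
  choose g hg using pow_ne c
  obtain ⟨i, j, hij, he⟩ := Finite.exists_ne_map_eq_of_infinite g
  wlog hlt : i < j generalizing i j
  · exact this j i hij.symm he.symm (by omega)
  obtain ⟨k, rfl⟩ : ∃ k, j = i + k := ⟨j - i, by omega⟩
  refine ⟨k, by omega, ?_⟩
  obtain ⟨l, rfl⟩ : ∃ l, k = l + 1 := ⟨k - 1, by omega⟩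
  have h1 := hg (i + (l + 1))
  rw [← he] at h1
  have h2 : e0 ∈ S c ^ (i + (l+1)) * S (star c) ^ i := by
    have h3 := star_pow (hg i)
    have h4 := mul_sub (S_sub h1) (S_sub h3)
    exact h4 _ (e0_star _)
  have h3 : c ∈ S c ^ (i + (l+1)) * S (star c) ^ i * S c := mem_of_e0 h2
  rw [show S c ^ (i + (l+1)) * S (star c) ^ i * S c
    = S c ^ (l + 1) * (S c ^ i * S (star c) ^ i * S c) by ring, powT, pow_succ] at h3
  have := cancel h3
  rwa [← pow_succ] at this

theorem NI [Finite T] {t : T} (h : t ∈ S t * S t) : ln t ≠ 1 := by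
  obtain ⟨n, hn, h1⟩ := fin_order t
  have h2 := K1 h
  have h3 : ∀ n, S t ^ (n+1) = S t := by
    intro n; induction n with
    | zero => simp
    | succ n ih => rw [pow_succ, ih, h2]
  obtain ⟨k, rfl⟩ : ∃ k, n = k + 1 := ⟨n - 1, by omega⟩
  rw [h3, mem_S] at h1
  intro h4; rw [← h1, (ln_zero _).2 rfl] at h4; omega

theorem eq_of {x y : T} {i j : ℕ} (h1 : ln x = i) (h2 : ln (star x) = j) (h3 : ln y = i)
    (h4 : ln (star y) = j) : x = y := ln_inj _ _ (by omega) (by omega)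

variable [Finite T]

def Main (T : Type*) [Hy T] (k : ℕ) : Prop :=
  ∀ b a h : T, ln b = 1 → ln (star b) = k → ln a = 1 → a ≠ b → ln h = 2 → ln (star h) + 1 = k →
    h ∈ S b * S a → ln (star a) + 1 = k ∧ a ∈ S b * S b ∧ e0 ∈ S a ^ k

theorem ne_of_star {x y : T} (h : ln (star x) ≠ ln (star y)) : x ≠ y := fun he => h (by rw [he])

theorem chain {k : ℕ} (IH : ∀ k', k' ≤ k → Main T k') {x t : T} (hx : ln x = 1)
    (hxk : ln (star x) = k) (ht : ln t = 1) (htk : ln (star t) < k) (h : e0 ∈ S x * S t ^ k) :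
    S x * S t = S t ∧ e0 ∈ S t ^ k := by
  have htp := star_pos ht
  suffices hs : S x * S t = S t by
    refine ⟨hs, ?_⟩
    rwa [powK hs (by omega)] at h
  have key : ∀ d j : ℕ, ∀ y : T, j + d + ln (star t) + 1 = k → ln y = 1 → ln (star y) + j = k →
      y ∈ S x * S t ^ j → S x * S t = S t := by
    intro d
    induction d with
    | zero =>
      intro j y hj hy hyk hm
      have e1 : S x * S t ^ (j+1) = S y * S t := by
        apply sub_antisymm
        · obtain ⟨i1, hi1, i2, hi2, hmm⟩ := hm
          rw [mem_S] at hi1; subst hi1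
          have h1 : i1 ∈ S (star i2) * S y := inv_mem (⟨_, rfl, _, rfl, m_comm _ _ _ hmm⟩)
          have h2 : S i1 ⊆ S (star t) ^ j * S y :=
            sub_trans (S_sub h1) (mul_subl (S_sub (star_pow hi2)) _)
          have h3 := mul_subl h2 (S t ^ (j+1))
          rwa [show S (star t) ^ j * S y * S t ^ (j+1) = S y * (S t ^ j * S (star t) ^ j * S t) by ring,
            powT] at h3
        · have := mul_subl (S_sub hm) (S t)
          rwa [show S x * S t ^ j * S t = S x * S t ^ (j+1) by ring] at this
      have hyt : ln (star y) = ln (star t) + 1 := by omega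
      have h1 : e0 ∈ S y * S t * S t ^ (ln (star t)) := by
        rw [← e1]
        have : k = j + 1 + ln (star t) := by omega
        rw [this, pow_add, ← mul_assoc] at h; exact h
      obtain ⟨g, hg, hg1, hg2, hg3⟩ := dich hy hyt htp ht (bpow ht _) h1
      rcases hg3 with hg3 | hg3
      · have hgt : g = t := eq_of hg3 hg2 ht rfl
        subst hgt
        rw [← e1] at hg
        rcases Nat.eq_zero_or_pos j with rfl | hjp
        · rw [zero_add, pow_one] at hg; exact K1 hg
        · obtain ⟨i, rfl⟩ : ∃ i, j = i + 1 := ⟨j - 1, by omega⟩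
          rw [show S x * S g ^ (i+1+1) = (S x * S g ^ i) * S g * S g by ring] at hg
          have := cancel hg
          rw [mul_assoc] at this
          have := circ this ((bpow ht i).mul (bS ht)); omega
      · obtain ⟨-, h3, h4⟩ := IH (ln (star t) + 1) (by omega) y t g hy hyt ht
          (ne_of_star (by omega)) hg3 (by omega) hg
        exfalso
        have h5 : t ∈ S y * S t := by
          have h6 : t ∈ (S y * S t * S t ^ (ln (star t))) * S t := mem_of_e0 h1
          rwa [show (S y * S t * S t ^ (ln (star t))) * S t = S y * (S t ^ (ln (star t) + 1) * S t) by ring,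
            P h4] at h6
        have h6 := K1 h5
        have h7 := mul_subl (S_sub h3) (S t)
        rw [mul_assoc, h6, h6] at h7
        refine NI (t := t) ?_ ht
        obtain ⟨g, hg⟩ := mul_ne t t
        have := h7 g hg
        rw [mem_S] at this; rwa [this] at hg
    | succ d ih =>
      intro j y hj hy hyk hm
      have e1 : S x * S t ^ (j+1) = S y * S t := by
        apply sub_antisymm
        · obtain ⟨i1, hi1, i2, hi2, hmm⟩ := hm
          rw [mem_S] at hi1; subst hi1
          have h1 : i1 ∈ S (star i2) * S y := inv_mem (⟨_, rfl, _, rfl, m_comm _ _ _ hmm⟩)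
          have h2 : S i1 ⊆ S (star t) ^ j * S y :=
            sub_trans (S_sub h1) (mul_subl (S_sub (star_pow hi2)) _)
          have h3 := mul_subl h2 (S t ^ (j+1))
          rwa [show S (star t) ^ j * S y * S t ^ (j+1) = S y * (S t ^ j * S (star t) ^ j * S t) by ring,
            powT] at h3
        · have := mul_subl (S_sub hm) (S t)
          rwa [show S x * S t ^ j * S t = S x * S t ^ (j+1) by ring] at this
      have hyt : ln (star y) = (ln (star t) + d + 1) + 1 := by omega
      have h1 : e0 ∈ S y * S t * S t ^ (ln (star t) + d + 1) := by
        rw [← e1]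
        have : k = j + 1 + (ln (star t) + d + 1) := by omega
        rw [this, pow_add, ← mul_assoc] at h; exact h
      obtain ⟨g, hg, hg1, hg2, hg3⟩ := dich hy hyt (by omega) ht (bpow ht _) h1
      rcases hg3 with hg3 | hg3
      · rw [← e1] at hg
        exact ih (j+1) g (by omega) hg3 (by omega) hg
      · obtain ⟨h3, -, -⟩ := IH (ln (star y)) (by omega) y t g hy rfl ht
          (ne_of_star (by omega)) hg3 (by omega) hg
        omega
  exact key (k - ln (star t) - 1) 0 x (by omega) hx (by omega) (by rw [pow_zero, mul_one]; rfl)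

theorem thmM {k : ℕ} (IH : ∀ k', k' ≤ k → Main T k') {s : T} (hs : ln s = 1)
    (hk : ln (star s) = k) :
    e0 ∈ S s ^ (k+1) ∨ (∃ v, ln v = 1 ∧ ln (star v) + 1 = k ∧ v ∈ S s * S s ∧ e0 ∈ S v ^ k) ∨
    (∃ v, ln v = 1 ∧ S s * S v = S v ∧ e0 ∈ S v ^ k) := by
  obtain ⟨U, hU, hc, h0⟩ := wordS s
  rw [hk] at hc
  have hk1 := star_pos hs
  by_cases hall : ∀ v, v ∈ U → v = s
  · left
    rw [repl1 (a := s) (fun v hv => by rw [hall v hv]), hc] at h0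
    rwa [pow_succ, mul_comm]
  push Not at hall
  obtain ⟨v0, hv0, hne⟩ := hall
  rcases Nat.lt_or_ge k 2 with hk2 | hk2
  · left
    have hk3 : k = 1 := by omega
    have e : star s = s := eq_of (hk.trans hk3) (by rw [star_star]; exact hs) hs (hk.trans hk3)
    rw [hk3, pow_two]; nth_rewrite 2 [← e]; exact e0_star s
  right
  obtain ⟨l, rfl⟩ : ∃ l, k = l + 1 := ⟨k - 1, by omega⟩
  by_cases hMC : ∃ v, v ∈ U ∧ v ≠ s ∧ ∃ g, g ∈ S s * S v ∧ ln g = 2 ∧ ln (star g) = l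
  · left
    obtain ⟨v, hv, hvs, g, hg, hg1, hg2⟩ := hMC
    obtain ⟨h1, h2, h3⟩ := IH (l+1) le_rfl s v g hs hk (hU v hv) hvs hg1 (by omega) hg
    exact ⟨v, hU v hv, h1, h2, h3⟩
  right
  have hd : ∀ v, v ∈ U → v ≠ s → ∃ g, g ∈ S s * S v ∧ ln g = 1 ∧ ln (star g) = l := by
    intro v hv hvs
    obtain ⟨U', rfl⟩ := Multiset.exists_cons_of_mem hv
    have hU' : Arc U' := fun w hw => hU w (by simp [hw])
    rw [PU_cons, ← mul_assoc] at h0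
    rw [Multiset.card_cons] at hc
    have hb := bPU hU'
    rw [show Multiset.card U' = l by omega] at hb
    obtain ⟨g, hg, hg1, hg2, hg3⟩ := dich hs hk (by omega) (hU v hv) hb h0
    rcases hg3 with hg3 | hg3
    · exact ⟨g, hg, hg3, hg2⟩
    · exact absurd ⟨v, hv, hvs, g, hg, hg3, hg2⟩ hMC
  obtain ⟨e, he, he1, he2⟩ := hd v0 hv0 hne
  have hns : s ∉ U := by
    intro hsU
    obtain ⟨U', rfl⟩ := Multiset.exists_cons_of_mem hv0
    have hsU' : s ∈ U' := by
      rcases Multiset.mem_cons.1 hsU with h | h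
      · exact absurd h.symm hne
      · exact h
    obtain ⟨W, rfl⟩ := Multiset.exists_cons_of_mem hsU'
    rw [PU_cons, PU_cons, show S s * (S v0 * (S s * PU W)) = S s * S v0 * S s * PU W by ring, R he,
      show S e * S s * PU W = S s * (S e * PU W) by ring] at h0
    have hW : Arc W := fun w hw => hU w (by simp [hw])
    have := circ h0 ((bS he1).mul (bPU hW))
    simp only [Multiset.card_cons] at hc
    omega
  have heq : ∀ v, v ∈ U → S s * S v = S s * S v0 := by
    intro v hv
    obtain ⟨e', h1, h2, h3⟩ := hd v hv (fun h => hns (h ▸ hv))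
    have : e' = e := eq_of h2 h3 he1 he2
    subst this
    exact L1 h1 he
  have hlt : ln (star v0) < l + 1 := by
    obtain ⟨U', rfl⟩ := Multiset.exists_cons_of_mem hv0
    have hU' : Arc U' := fun w hw => hU w (by simp [hw])
    rw [PU_cons, show S s * (S v0 * PU U') = S v0 * (S s * PU U') by ring] at h0
    have h1 := circ h0 ((bS hs).mul (bPU hU'))
    rw [Multiset.card_cons] at hc
    have : ln (star v0) ≠ l + 1 := fun h => hne (eq_of (hU v0 hv0) h hs hk)
    omega
  rw [repl1 heq, hc] at h0
  obtain ⟨h1, h2⟩ := chain IH hs hk (hU v0 hv0) hlt h0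
  exact ⟨v0, hU v0 hv0, h1, h2⟩

/-- two-case form -/
theorem thmM2 {k : ℕ} (IH : ∀ k', k' ≤ k → Main T k') {s : T} (hs : ln s = 1)
    (hk : ln (star s) = k) :
    (∃ Y : CS T, Bd Y (k - 1) ∧ e0 ∈ S s * S s * Y) ∨
    (∃ v, ln v = 1 ∧ S s * S v = S v ∧ e0 ∈ S v ^ k) := by
  have hk1 := star_pos hs
  obtain ⟨l, rfl⟩ : ∃ l, k = l + 1 := ⟨k - 1, by omega⟩
  rcases thmM IH hs hk with h | ⟨v, h1, h2, h3, h4⟩ | h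
  · left
    refine ⟨S s ^ l, bpow hs l, ?_⟩
    rwa [show S s * S s * S s ^ l = S s ^ (l+1+1) by ring]
  · left
    refine ⟨S v ^ l, bpow h1 l, ?_⟩
    rw [pow_succ, mul_comm] at h4
    exact mul_subl (S_sub h3) _ _ h4
  · exact Or.inr h

theorem lemX {c s : T} (IH : ∀ k', k' ≤ ln (star s) → Main T k') (hc : ln c = 1) (hs : ln s = 1)
    (hlt : ln (star s) < ln (star c)) (h : S c * S s = S c * S c) : False := by
  have hk1 := star_pos hs
  rcases thmM2 IH hs rfl with ⟨Y, hY, h0⟩ | ⟨v, hv, h1, h2⟩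
  · have h1 : c ∈ S s * S s * Y * S c := mem_of_e0 h0
    rw [show S s * S s * Y * S c = (S c * S s) * S s * Y by ring, h,
      show S c * S c * S s * Y = (S c * S s) * S c * Y by ring, h,
      show S c * S c * S c * Y = (Y * S c) * S c * S c by ring] at h1
    have h2 := cancel h1
    rw [show Y * S c * S c = S c * (S c * Y) by ring] at h2
    have := circ h2 ((bS hc).mul hY); omega
  · have h3 : S c * (S c * S v) = S c * S v := by
      rw [← mul_assoc, ← h, mul_assoc, h1]
    have h4 : ∀ n, S c ^ (n+1) * S v = S c * S v := by
      intro n; induction n with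
      | zero => simp
      | succ n ih => rw [pow_succ, show S c ^ (n+1) * S c * S v = S c * (S c ^ (n+1) * S v) by ring, ih, h3]
    obtain ⟨n, hn, h5⟩ := fin_order c
    obtain ⟨i, rfl⟩ : ∃ i, n = i + 1 := ⟨n - 1, by omega⟩
    have h6 : v ∈ S c ^ (i+1) * S v := mem_of_e0 h5
    rw [h4] at h6
    rw [← powK (K1 h6) hk1] at h2
    have := circ h2 (bpow hv _); omega

theorem lemY {b s : T} (IH : ∀ k', k' ≤ ln (star s) → Main T k') (hs : ln s = 1)
    (hlt : ln (star s) < ln (star b)) (h : S b * S s = S s * S s) : False := by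
  have hk1 := star_pos hs
  rcases thmM2 IH hs rfl with ⟨Y, hY, h0⟩ | ⟨v, hv, h1, h2⟩
  · rw [← h, mul_assoc] at h0
    have := circ h0 ((bS hs).mul hY); omega
  · have h3 : S b * S v = S v := by
      calc S b * S v = S b * (S s * S v) := by rw [h1]
        _ = S s * S s * S v := by rw [← mul_assoc, h]
        _ = S v := by rw [mul_assoc, h1, h1]
    rw [← powK h3 hk1] at h2
    have := circ h2 (bpow hv _); omega

/-- `c ∈ bs`, `cs = s` is impossible -/
theorem lemW {b c s : T} (hs : ln s = 1) (hb : 2 ≤ ln (star b)) (h : c ∈ S b * S s)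
    (h1 : S c * S s = S s) : False := by
  have h2 := mul_subl (S_sub h) (S s)
  rw [h1] at h2
  have h3 := cancel (h2 s rfl)
  have := circ h3 (bS hs); omega

/-- `h ∈ ba`, `ha = a` is impossible -/
theorem mem_K_false {a b h : T} (ha : ln a = 1) (hb : 2 ≤ ln (star b)) (hh : h ∈ S b * S a)
    (h1 : S h * S a = S a) : False := lemW ha hb hh h1


theorem circE {x : T} {Y Z : CS T} {n : ℕ} (h : e0 ∈ Z) (e : Z = S x * Y) (hb : Bd Y n) :
    ln (star x) ≤ n := by rw [e] at h; exact circ h hb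

theorem ln_ne {x y : T} (h : ln x ≠ ln y) : x ≠ y := fun he => h (by rw [he])

theorem lemV {n : ℕ} {a b c h : T} (hb : ln b = 1) (hbk : ln (star b) = n + 3) (hc : ln c = 1)
    (hck : ln (star c) = n + 2) (ha : ln a = 1) (hak : ln (star a) = n + 1) (hh2 : ln h = 2)
    (hhk : ln (star h) = n + 2) (hh : h ∈ S b * S a) (hbc : S b * S c = S c)
    (hac : a ∈ S c * S c) (hap : e0 ∈ S a ^ (n+2)) : False := by
  obtain ⟨k, hk⟩ := mul_ne b b
  obtain ⟨g, hg⟩ := mul_ne k a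
  have hgb : g ∈ S b * S b * S a := mul_subl (S_sub hk) _ _ hg
  have hgc : g ∈ S c * S c := by
    have := mul_subr (S b * S b) (S_sub hac) _ hgb
    rwa [show S b * S b * (S c * S c) = (S b * S c) * (S b * S c) by ring, hbc] at this
  have h1 := ln_two hc hc hgc
  have h2 := lowb hc hgc
  have h3 : ln g ≠ 0 := fun h0 => by have := star_of_zero h0; omega
  have h4 : S g * S c = S a * S c := by rw [← R hgc, ← R hac]
  have h5 : e0 ∈ S g * (S c * S c * S a ^ n) := by
    rw [show S g * (S c * S c * S a ^ n) = (S g * S c) * (S c * S a ^ n) by ring, h4,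
      show S a * S c * (S c * S a ^ n) = S c * S c * (S a * S a ^ n) by ring]
    refine mul_subl (S_sub hac) _ _ ?_
    rwa [show S a * (S a * S a ^ n) = S a ^ (n+2) by ring]
  have h6 := circ h5 (((bS hc).mul (bS hc)).mul (bpow ha n))
  have hba : a ∉ S b * S a := by
    intro hm
    have := K1 hm; rw [this, mem_S] at hh
    exact ln_ne (by omega) hh
  rcases (by omega : ln (star g) = n + 2 ∨ ln (star g) = n + 1) with h7 | h7 <;>
    rcases (by omega : ln g = 1 ∨ ln g = 2) with h8 | h8
  · have : g = c := eq_of h8 h7 hc hck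
    subst this; exact NI hgc hc
  · have : g = h := eq_of h8 h7 hh2 hhk
    subst this
    have h9 := inv_mem hh
    have h10 := mul_subr (S (star b)) (S_sub hgb) _ h9
    rw [show S (star b) * (S b * S b * S a) = (S b * S (star b) * S b) * S a by ring, thickS] at h10
    exact hba h10
  · have : g = a := eq_of h8 h7 ha hak
    subst this
    have h9 := K1 hg
    have h10 : e0 ∈ S k * S g ^ (n+2) := by rwa [powK h9 (by omega)]
    have h11 := circ h10 (bpow ha _)
    have h12 := lowb hb hk
    have h13 := ln_two hb hb hk
    have h14 : ln k ≠ 0 := fun h0 => by have := star_of_zero h0; omega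
    rcases (by omega : ln k = 1 ∨ ln k = 2) with h15 | h15
    · have : k = c := eq_of h15 (by omega) hc hck
      subst this
      have h16 := mul_subl (S_sub hac) (S g)
      rw [mul_assoc, h9, h9] at h16
      obtain ⟨w, hw⟩ := mul_ne g g
      have h17 := h16 w hw
      rw [mem_S] at h17; subst h17
      exact NI hw ha
    · have : k = h := eq_of h15 (by omega) hh2 hhk
      subst this
      exact mem_K_false ha (by omega) hh h9
  · obtain ⟨U, hU, hUc, h9⟩ := wordS g
    rw [h7] at hUc
    have h10 := mul_subl (S_sub hgc) (PU U) _ h9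
    have h11 : ∀ v, v ∈ U → S c * S v = S c * S c := by
      intro v hv
      obtain ⟨U', rfl⟩ := Multiset.exists_cons_of_mem hv
      rw [Multiset.card_cons] at hUc
      have hU' : Arc U' := fun w hw => hU w (by simp [hw])
      rw [PU_cons, show S c * S c * (S v * PU U') = S c * S v * (S c * PU U') by ring] at h10
      have hB : Bd (S c * PU U') (n+1) := by
        have := (bS hc).mul (bPU hU'); rwa [show 1 + Multiset.card U' = n + 1 by omega] at this
      obtain ⟨g', q1, q2, q3, q4⟩ := dich hc hck (by omega) (hU v hv) hB h10
      rcases q4 with q4 | q4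
      · have : g' = a := eq_of q4 q3 ha hak
        subst this; exact L1 q1 hac
      · have : g' = g := eq_of q4 q3 h8 h7
        subst this; exact L1 q1 hgc
    rw [mul_assoc, repl1 h11, hUc, show S c * (S c * S c ^ (n+1)) = S c ^ (n+3) by ring] at h10
    have h12 := pow_sub (S_sub hac) _ _ hap
    rw [show (S c * S c) ^ (n+2) = S c ^ (n+3) * S c * S c ^ n by ring, P h10] at h12
    have := circ h12 (bpow hc n); omega

theorem lemZ {n : ℕ} {a b c h s : T} (hb : ln b = 1) (hbk : ln (star b) = n + 3) (hc : ln c = 1)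
    (hck : ln (star c) = n + 2) (ha : ln a = 1) (hak : ln (star a) < n + 2) (hh2 : ln h = 2)
    (hhk : ln (star h) = n + 2) (hh : h ∈ S b * S a) (hs : ln s = 1) (hcs : c ∈ S b * S s)
    (hca : S c * S a = S a) (hap : e0 ∈ S a ^ (n+2)) : False := by
  have hba : a ∉ S b * S a := by
    intro hm
    have := K1 hm; rw [this, mem_S] at hh
    exact ln_ne (by omega) hh
  have hbs : e0 ∉ S b * S s := fun h0 => by have := circ h0 (bS hs); omega
  have hak' : ln (star a) = n + 1 := by
    obtain ⟨U, hU, hUc, h9⟩ := wordS a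
    rw [← hca, mul_assoc] at h9
    have := circ h9 ((bS ha).mul (bPU hU)); omega
  have hy : ∀ y, y ∈ S b * S c → ln (star y) = n + 3 := by
    intro y hy
    have h1 := ln_two hb hc hy
    have h2 := lowb hc hy
    have h3 : ln y ≠ 0 := fun h0 => by have := star_of_zero h0; omega
    have h4 : S y * S a ⊆ S b * S a := by
      have := mul_subl (S_sub hy) (S a); rwa [mul_assoc, hca] at this
    have h5 : S b * S a ⊆ S y * S a := by
      have hy' := hy
      rw [mul_comm] at hy'
      have := mul_subl (S_sub (inv_mem hy')) (S a)
      rwa [show S (star c) * S y * S a = S y * (S (star c) * S a) by ring, starK hca] at this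
    have h6 : e0 ∈ S y * (S s * S a ^ (n+2)) := by
      have h7 : S b * S s * S a ^ (n+2) ⊆ S y * (S s * S a ^ (n+2)) := by
        have := mul_subl h5 (S s * S a ^ (n+1))
        rwa [show S b * S a * (S s * S a ^ (n+1)) = S b * S s * S a ^ (n+2) by ring,
          show S y * S a * (S s * S a ^ (n+1)) = S y * (S s * S a ^ (n+2)) by ring] at this
      apply h7
      apply mul_subl (S_sub hcs)
      rwa [powK hca (by omega)]
    have h7 := circ h6 ((bS hs).mul (bpow ha _))
    by_contra hne
    have h8 : ln (star y) = n + 2 := by omega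
    rcases (by omega : ln y = 1 ∨ ln y = 2) with h9 | h9
    · have : y = c := eq_of h9 h8 hc hck
      subst this
      have h10 := K1 hy
      apply hba
      rw [← hca, ← mul_assoc, h10, hca]; rfl
    · have : y = h := eq_of h9 h8 hh2 hhk
      subst this
      have e := L1 hh hy
      have h10 : a ∈ S b * S s := by
        have := inv_mem hh
        have := mul_subr (S (star b)) (S_sub hh) _ this
        rw [e] at this
        have := mul_subr (S (star b)) (mul_subr (S b) (S_sub hcs)) _ this
        rwa [show S (star b) * (S b * (S b * S s)) = (S b * S (star b) * S b) * S s by ring,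
          thickS] at this
      apply hbs
      have h11 : b ∈ S (star s) * S a := inv_mem (by rwa [mul_comm])
      have h12 : c ∈ S (star s) * S a * S s := mul_subl (S_sub h11) _ _ hcs
      rw [mem_iff, show S (star s) * S a * S s * S (star c) = S (star s) * S s * (S (star c) * S a) by ring,
        starK hca] at h12
      have h13 := mul_subr (S (star s) * S s) (S_sub h10) _ h12
      rwa [show S (star s) * S s * (S b * S s) = S b * (S s * S (star s) * S s) by ring, thickS] at h13
  obtain ⟨d, hd⟩ := mul_ne c c
  have hda : S d * S a = S a := by
    apply K1
    rw [K1]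
    · rfl
    · obtain ⟨w, hw⟩ := mul_ne d a
      have := mul_subl (S_sub hd) (S a) _ hw
      rw [mul_assoc, hca, hca, mem_S] at this
      rwa [this] at hw
  have h1 := ln_two hc hc hd
  have h2 := lowb hc hd
  have h3 : ln d ≠ 0 := fun h0 => by have := star_of_zero h0; omega
  have h4 : e0 ∈ S d * S a ^ (n+2) := by rwa [powK hda (by omega)]
  have h5 := circ h4 (bpow ha _)
  rcases (by omega : ln (star d) = n + 2 ∨ ln (star d) = n + 1) with h7 | h7 <;>
    rcases (by omega : ln d = 1 ∨ ln d = 2) with h8 | h8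
  · have : d = c := eq_of h8 h7 hc hck
    subst this; exact NI hd hc
  · have : d = h := eq_of h8 h7 hh2 hhk
    subst this; exact mem_K_false ha (by omega) hh hda
  · have : d = a := eq_of h8 h7 ha hak'
    subst this
    exact NI (by rw [hda]; rfl) ha
  · obtain ⟨U, hU, hUc, h9⟩ := wordS d
    rw [h7] at hUc
    have h10 := mul_subl (S_sub hd) (PU U) _ h9
    have h11 : ∀ v, v ∈ U → S c * S v = S c * S c := by
      intro v hv
      obtain ⟨U', rfl⟩ := Multiset.exists_cons_of_mem hv
      rw [Multiset.card_cons] at hUc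
      have hU' : Arc U' := fun w hw => hU w (by simp [hw])
      rw [PU_cons, show S c * S c * (S v * PU U') = S c * S v * (S c * PU U') by ring] at h10
      have hB : Bd (S c * PU U') (n+1) := by
        have := (bS hc).mul (bPU hU'); rwa [show 1 + Multiset.card U' = n + 1 by omega] at this
      obtain ⟨g', q1, q2, q3, q4⟩ := dich hc hck (by omega) (hU v hv) hB h10
      rcases q4 with q4 | q4
      · exfalso
        have : g' = a := eq_of q4 q3 ha hak'
        subst this
        have h12 := inv_mem q1
        rw [starK hca, mem_S] at h12
        subst h12
        rw [show S c * S v * (S c * PU U') = S c * (S c * S v) * PU U' by ring, hca, hca] at h10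
        have := circ h10 (bPU hU'); omega
      · have : g' = d := eq_of q4 q3 h8 h7
        subst this; exact L1 q1 hd
    rw [mul_assoc, repl1 h11, hUc] at h10
    have h12 := mul_subl (S_sub hcs) _ _ h10
    rw [show S b * S s * (S c * S c ^ (n+1)) = (S b * S c) * (S s * S c ^ (n+1)) by ring] at h12
    obtain ⟨y, hy1, hy2⟩ := split h12
    have := hy y hy1
    have := circ hy2 ((bS hs).mul (bpow hc _)); omega

theorem lemQ {n : ℕ} {a b h s : T} (IH : ∀ k', k' < n + 3 → Main T k')
    (hb : ln b = 1) (hbk : ln (star b) = n + 3)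
    (ha : ln a = 1) (hak : ln (star a) = n + 2) (hh2 : ln h = 2)
    (hhk : ln (star h) = n + 2) (hh : h ∈ S b * S a) (hs : ln s = 1) (has : a ∈ S b * S s)
    (hsa : ln (star s) < n + 2) (h0 : e0 ∈ S b * S a ^ (n+2) * S s) : False := by
  have hbne : b ≠ a := ne_of_star (by omega)
  have h1 : e0 ∈ S a * S s * (S b * S a ^ (n+1)) := by
    rwa [show S a * S s * (S b * S a ^ (n+1)) = S b * S a ^ (n+2) * S s by ring]
  obtain ⟨g, hg, hg0⟩ := split h1
  have h2 := circ hg0 ((bS hb).mul (bpow ha _))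
  have h3 := ln_two ha hs hg
  have h4 := lowb hs hg
  have h5 : ln g ≠ 0 := fun h0 => by have := star_of_zero h0; omega
  have hlemX : S a * S s ≠ S a * S a := fun e =>
    lemX (fun k' hk' => IH k' (by omega)) ha hs (by omega) e
  rcases (by omega : ln (star g) = n + 2 ∨ ln (star g) = n + 1) with h7 | h7 <;>
    rcases (by omega : ln g = 1 ∨ ln g = 2) with h8 | h8
  · have : g = a := eq_of h8 h7 ha hak
    subst this
    have h9 : S s * S g = S g := K1 (by rwa [mul_comm])
    have h10 : b ∈ S (star s) * S g := inv_mem (by rwa [mul_comm])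
    rw [starK h9, mem_S] at h10
    exact hbne h10
  · have : g = h := eq_of h8 h7 hh2 hhk
    subst this
    have e : S a * S s = S a * S b := L1 hg (by rwa [mul_comm])
    have h9 : S a * S a ⊆ S a * S s * S s := by
      rw [e, mul_assoc]; exact mul_subr _ (S_sub has)
    have h10 : a ∈ S (star a) * (S a * S a) := by
      rw [show S (star a) * (S a * S a) = S a * S (star a) * S a by ring, thickS]; rfl
    have h11 := mul_subr (S (star a)) h9 _ h10
    rw [mem_iff, show S (star a) * (S a * S s * S s) * S (star a)
      = S s * S s * (S (star a) * S (star (star a)) * S (star a)) by rw [star_star]; ring, thickS,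
      ← mem_iff] at h11
    exact lemY (fun k' hk' => IH k' (by omega)) hs (by omega) (b := b)
      (by rw [mul_comm (S b)]; exact L1 (by rwa [mul_comm]) h11)
  · obtain ⟨U, hU, hUc, h9⟩ := wordS g
    rw [h7] at hUc
    have h10 := mul_subl (S_sub hg) (PU U) _ h9
    have h11 : ∀ v, v ∈ U → S a * S v = S a * S s := by
      intro v hv
      obtain ⟨U', rfl⟩ := Multiset.exists_cons_of_mem hv
      rw [Multiset.card_cons] at hUc
      have hU' : Arc U' := fun w hw => hU w (by simp [hw])
      have hva : v ≠ a := by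
        rintro rfl
        rw [PU_cons, ← mul_assoc, R hg] at h10
        have := circE h10 (show S g * S v * PU U' = S v * (S g * PU U') by ring)
          ((bS h8).mul (bPU hU')); omega
      rw [PU_cons, show S a * S s * (S v * PU U') = S a * S v * (S s * PU U') by ring] at h10
      have hB : Bd (S s * PU U') (n+1) := by
        have := (bS hs).mul (bPU hU'); rwa [show 1 + Multiset.card U' = n + 1 by omega] at this
      obtain ⟨g', q1, q2, q3, q4⟩ := dich ha hak (by omega) (hU v hv) hB h10
      rcases q4 with q4 | q4
      · have : g' = g := eq_of q4 q3 h8 h7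
        subst this; exact L1 q1 hg
      · exfalso
        obtain ⟨w1, w2, -⟩ := IH (n+2) (by omega) a v g' ha hak (hU v hv) hva q4 (by omega) q1
        have : v = g := eq_of (hU v hv) (by omega) h8 h7
        subst this
        exact hlemX (L1 hg w2)
    rw [show S a * S s * PU U = S s * (S a * PU U) by ring, repl1 h11, hUc,
      show S s * (S a * S s ^ (n+1)) = S a * S s ^ (n+2) by ring] at h10
    obtain ⟨w1, -⟩ := chain (fun k' hk' => IH k' (by omega)) ha hak hs hsa h10
    exact lemW hs (by omega) has w1
  · obtain ⟨w1, w2, w3⟩ := IH (n+2) (by omega) a s g ha hak hs (ne_of_star (by omega)) h8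
      (by omega) hg
    have w4 : star s ∈ S s ^ (n+1) := by
      rw [← e0_S]; rwa [pow_succ, mul_comm] at w3
    have w5 := star_pow w4
    rw [star_star] at w5
    -- star s ∈ b * star a
    have w6 : star s ∈ S b * S (star a) := by
      have : e0 ∈ S s * (S b * S (star a)) := by
        rw [show S s * (S b * S (star a)) = S b * S s * S (star a) by ring, ← mem_iff]; exact has
      exact e0_S.1 this
    have w7 := pow_sub (S_sub w6) _ _ w5
    have w8 := mul_subr (S b * S a ^ (n+2)) (S_sub w7) _ h0
    rw [mul_pow, show S b * S a ^ (n+2) * (S b ^ (n+1) * S (star a) ^ (n+1))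
      = S b * S b ^ (n+1) * (S a ^ (n+1) * S (star a) ^ (n+1) * S a) by ring, powT, mul_assoc] at w8
    have := circ w8 ((bpow hb _).mul (bS ha))
    omega

theorem caseA {n : ℕ} {a b h : T} (IH : ∀ k', k' < n + 2 → Main T k')
    (hb : ln b = 1) (hbk : ln (star b) = n + 2)
    (ha : ln a = 1) (hak : ln (star a) < n + 2) (hh2 : ln h = 2) (hh : h ∈ S b * S a)
    (h0 : e0 ∈ S b * S a ^ (n+2)) : False := by
  have hap := star_pos ha
  have hba : a ∉ S b * S a := by
    intro hm
    have := K1 hm; rw [this, mem_S] at hh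
    exact ln_ne (by omega) hh
  rcases thmM (fun k' hk' => IH k' (by omega)) ha rfl with h1 | ⟨v, h1, h2, h3, h4⟩ | ⟨v, h1, h2, h3⟩
  · rcases (by omega : ln (star a) + 1 = n + 2 ∨ ln (star a) + 1 < n + 2) with h2 | h2
    · rw [h2] at h1
      have h3 : a ∈ S b * S a ^ (n+2) * S a := mem_of_e0 h0
      rw [mul_assoc, P h1] at h3
      exact hba h3
    · obtain ⟨l, hl⟩ : ∃ l, n + 2 = (ln (star a) + 1) + 1 + l := ⟨n - ln (star a), by omega⟩
      rw [hl, pow_add, pow_succ, P h1] at h0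
      have := circ h0 ((bS ha).mul (bpow ha l)); omega
  · have hvp := star_pos h1
    obtain ⟨l, rfl⟩ : ∃ l, n = l + 1 := ⟨n - 1, by omega⟩
    rw [show S b * S a ^ (l+1+2) = S b * ((S a * S a * S a) * S a ^ l) by ring, R h3] at h0
    have := circ h0 (((bS h1).mul (bS ha)).mul (bpow ha l)); omega
  · have h4 : v ∈ S b * S a ^ (n+2) * S v := mem_of_e0 h0
    have h5 : ∀ k, S a ^ k * S v = S v := by
      intro k; induction k with
      | zero => simp
      | succ k ih => rw [pow_succ, mul_assoc, h2, ih]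
    rw [mul_assoc, h5] at h4
    rw [← powK (K1 h4) hap] at h3
    have := circ h3 (bpow h1 _); omega

theorem caseB {n m l : ℕ} {a b c h s : T} (IH : ∀ k', k' < n + 2 → Main T k')
    (hb : ln b = 1) (hbk : ln (star b) = n + 2)
    (ha : ln a = 1) (hak : ln (star a) < n + 2) (hh2 : ln h = 2) (hhk : ln (star h) = n + 1)
    (hh : h ∈ S b * S a) (hs : ln s = 1) (hc : ln c = 1) (hck : ln (star c) = n + 1)
    (hcs : c ∈ S b * S s) (hne : S b * S s ≠ S b * S a) (hml : m + l = n) 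
    (h0 : e0 ∈ S b * S a ^ (m+1) * S s ^ (l+1)) :
    ln (star a) + 1 = n + 2 ∧ a ∈ S b * S b ∧ e0 ∈ S a ^ (n+2) := by
  have hap := star_pos ha
  have hsp := star_pos hs
  have hsa : s ≠ a := fun e => hne (by rw [e])
  -- reduction
  have h1 : e0 ∈ S c * (S a ^ (m+1) * S s ^ l) := by
    have h2 : e0 ∈ S b * S s * (S a ^ (m+1) * S s ^ l) := by
      rwa [show S b * S s * (S a ^ (m+1) * S s ^ l) = S b * S a ^ (m+1) * S s ^ (l+1) by ring]
    have hB : Bd (S a ^ (m+1) * S s ^ l) (n+1) := by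
      have := (bpow ha (m+1)).mul (bpow hs l); rwa [show m + 1 + l = n + 1 by omega] at this
    obtain ⟨g, q1, q2, q3, q4⟩ := dich hb hbk (by omega) hs hB h2
    rcases q4 with q4 | q4
    · have : g = c := eq_of q4 q3 hc hck
      rwa [this] at q2
    · have : g = h := eq_of q4 q3 hh2 hhk
      subst this; exact absurd (L1 q1 hh) hne
  have hs0 : ln (star s) ≤ n + 2 := by
    have := circE h0 (show _ = S s * (S b * S a ^ (m+1) * S s ^ l) by ring)
      (((bS hb).mul (bpow ha _)).mul (bpow hs l)); omega
  rcases Nat.eq_zero_or_pos l with rfl | hl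
  · -- l = 1
    have hmn : m = n := by omega
    subst hmn
    rw [pow_zero, mul_one] at h1
    by_cases hca : c = a
    · subst hca
      have h2 : e0 ∈ S c ^ (m+2) := by rwa [show S c ^ (m+2) = S c * S c ^ (m+1) by ring]
      by_cases hsb : s = b
      · subst hsb; exact ⟨by omega, hcs, h2⟩
      · exfalso
        have h3 : ln (star s) ≠ m + 2 := fun e => hsb (eq_of hs e hb hbk)
        have h4 : ln (star s) ≠ m + 1 := fun e => hsa (eq_of hs e hc hck)
        obtain ⟨k, rfl⟩ : ∃ k, m = k + 1 := ⟨m - 1, by omega⟩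
        exact lemQ IH hb hbk hc hck hh2 hhk hh hs hcs (by omega)
          (by rwa [zero_add, pow_one] at h0)
    · exfalso
      have h3 : ln (star a) ≠ m + 1 := fun e => hca (eq_of hc hck ha e)
      obtain ⟨w1, w2⟩ := chain (fun k' hk' => IH k' (by omega)) hc hck ha (by omega) h1
      obtain ⟨k, rfl⟩ : ∃ k, m = k + 1 := ⟨m - 1, by omega⟩
      exact lemZ hb hbk hc hck ha (by omega) hh2 hhk hh hs hcs w1 w2
  · exfalso
    obtain ⟨l, rfl⟩ : ∃ k, l = k + 1 := ⟨l - 1, by omega⟩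
    obtain ⟨n, rfl⟩ : ∃ k, n = k + 1 := ⟨n - 1, by omega⟩
    have hsb : s ≠ b := by
      rintro rfl
      rw [show S s * S a ^ (m+1) * S s ^ (l+1+1) = (S s * S s * S s) * (S a ^ (m+1) * S s ^ l) by ring,
        R hcs] at h0
      have := circE h0 (show _ = S s * (S c * (S a ^ (m+1) * S s ^ l)) by ring)
        ((bS hc).mul ((bpow ha _).mul (bpow hs l))); omega
    have hs1 : ln (star s) ≠ n + 3 := fun e => hsb (eq_of hs e hb hbk)
    have hBs : Bd (S a ^ (m+1) * S s ^ l) (n+1) := by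
      have := (bpow ha (m+1)).mul (bpow hs l); rwa [show m + 1 + l = n + 1 by omega] at this
    have hBa : Bd (S a ^ m * S s ^ (l+1)) (n+1) := by
      have := (bpow ha m).mul (bpow hs (l+1)); rwa [show m + (l + 1) = n + 1 by omega] at this
    have h2s : e0 ∈ S c * S s * (S a ^ (m+1) * S s ^ l) := by
      rwa [show S c * S s * (S a ^ (m+1) * S s ^ l) = S c * (S a ^ (m+1) * S s ^ (l+1)) by ring]
    have h2a : e0 ∈ S c * S a * (S a ^ m * S s ^ (l+1)) := by
      rwa [show S c * S a * (S a ^ m * S s ^ (l+1)) = S c * (S a ^ (m+1) * S s ^ (l+1)) by ring]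
    obtain ⟨gs, s1, s2, s3, s4⟩ := dich hc hck (by omega) hs hBs h2s
    by_cases hca : c = a
    · subst hca
      have hs2 : ln (star s) ≠ n + 2 := fun e => hsa (eq_of hs e hc hck)
      rcases s4 with s4 | s4
      · rw [show S c * (S c ^ (m+1) * S s ^ (l+1)) = (S c * S s * S c) * (S c ^ m * S s ^ l) by ring,
          R s1] at h1
        have := circE h1 (show _ = S c * (S gs * (S c ^ m * S s ^ l)) by ring)
          ((bS s4).mul ((bpow hc m).mul (bpow hs l))); omega
      · obtain ⟨w1, w2, w3⟩ := IH (n+2) (by omega) c s gs hc hck hs hsa s4 (by omega) s1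
        rcases Nat.eq_zero_or_pos m with rfl | hm
        · have h3 : S b * S c ^ (0+1) * S s ^ (l+1+1) ⊆ S b * S b * S s * S s ^ (l+1+1) := by
            have := mul_subl (mul_subr (S b) (S_sub hcs)) (S s ^ (l+1+1))
            rwa [zero_add, pow_one, show S b * S b * S s * S s ^ (l+1+1) = S b * (S b * S s) * S s ^ (l+1+1) by ring]
          have h4 := h3 _ h0
          have e : l + 1 + 1 = n + 2 := by omega
          rw [e, show S b * S b * S s * S s ^ (n+2) = S b * S b * (S s ^ (n+2) * S s) by ring, P w3,
            mul_assoc] at h4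
          have := circ h4 ((bS hb).mul (bS hs)); omega
        · obtain ⟨m, rfl⟩ : ∃ k, m = k + 1 := ⟨m - 1, by omega⟩
          rw [show S c * (S c ^ (m+1+1) * S s ^ (l+1)) = (S c * S c * S c) * (S c ^ m * S s ^ (l+1)) by ring,
            R w2] at h1
          have := circE h1 (show _ = S c * (S s * (S c ^ m * S s ^ (l+1))) by ring)
            ((bS hs).mul ((bpow hc m).mul (bpow hs (l+1)))); omega
    · have ha1 : ln (star a) ≠ n + 2 := fun e => hca (eq_of hc hck ha e)
      have hac : a ≠ c := fun e => hca e.symm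
      obtain ⟨ga, a1, a2, a3, a4⟩ := dich hc hck (by omega) ha hBa h2a
      by_cases hsc : s = c
      · subst hsc
        rcases a4 with a4 | a4
        · rw [show S s * (S a ^ (m+1) * S s ^ (l+1)) = (S s * S a * S s) * (S a ^ m * S s ^ l) by ring,
            R a1] at h1
          have := circE h1 (show _ = S s * (S ga * (S a ^ m * S s ^ l)) by ring)
            ((bS a4).mul ((bpow ha m).mul (bpow hs l))); omega
        · obtain ⟨w1, w2, w3⟩ := IH (n+2) (by omega) s a ga hc hck ha hac a4 (by omega) a1
          rcases Nat.eq_zero_or_pos l with rfl | hl'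
          · exact lemV hb hbk hc hck ha (by omega) hh2 hhk hh (K1 hcs) w2 w3
          · obtain ⟨l, rfl⟩ : ∃ k, l = k + 1 := ⟨l - 1, by omega⟩
            rw [show S s * (S a ^ (m+1) * S s ^ (l+1+1)) = (S s * S s * S s) * (S a ^ (m+1) * S s ^ l) by ring,
              R w2] at h1
            have := circE h1 (show _ = S s * (S a * (S a ^ (m+1) * S s ^ l)) by ring)
              ((bS ha).mul ((bpow ha (m+1)).mul (bpow hs l))); omega
      · have hs2 : ln (star s) ≠ n + 2 := fun e => hsc (eq_of hs e hc hck)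
        rcases a4 with a4 | a4
        · rcases s4 with s4 | s4
          · have : ga = gs := eq_of a4 a3 s4 s3
            subst this
            have e := L1 a1 s1
            have e2 : ∀ k, S c * S a ^ k = S c * S s ^ k := by
              intro k; induction k with
              | zero => simp
              | succ k ih =>
                rw [pow_succ, ← mul_assoc, ih, show S c * S s ^ k * S a = (S c * S a) * S s ^ k by ring,
                  e]; ring
            rw [← mul_assoc, e2, mul_assoc, ← pow_add, show m + 1 + (l + 1) = n + 2 by omega] at h1
            obtain ⟨w1, -⟩ := chain (fun k' hk' => IH k' (by omega)) hc hck hs (by omega) h1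
            exact lemW hs (by omega) hcs w1
          · obtain ⟨w1, w2, w3⟩ := IH (n+2) (by omega) c s gs hc hck hs hsc s4 (by omega) s1
            have : ga = s := eq_of a4 a3 hs (by omega)
            subst this
            exact lemX (fun k' hk' => IH k' (by omega)) hc ha (by omega) (L1 a1 w2)
        · obtain ⟨w1, w2, w3⟩ := IH (n+2) (by omega) c a ga hc hck ha hac a4 (by omega) a1
          rcases s4 with s4 | s4
          · have : gs = a := eq_of s4 s3 ha (by omega)
            subst this
            exact lemX (fun k' hk' => IH k' (by omega)) hc hs (by omega) (L1 s1 w2)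
          · obtain ⟨w4, -, -⟩ := IH (n+2) (by omega) c s gs hc hck hs hsc s4 (by omega) s1
            exact hsa (eq_of hs (show _ = n + 1 by omega) ha (by omega))

theorem main (k : ℕ) : Main T k := by
  induction k using Nat.strong_induction_on with
  | _ k IH =>
  intro b a h hb hbk ha hab hh2 hhk hh
  have h0 : ln (star h) ≠ 0 := by
    intro h0
    have := star_of_zero h0
    rw [star_star] at this; omega
  obtain ⟨n, rfl⟩ : ∃ n, k = n + 2 := ⟨k - 2, by omega⟩
  have hhk' : ln (star h) = n + 1 := by omega
  obtain ⟨U, hU, hUc, h1⟩ := wordS h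
  rw [hhk'] at hUc
  have h2 := mul_subl (S_sub hh) _ _ h1
  have hak : ln (star a) < n + 2 := by
    have h3 := circE h2 (show _ = S a * (S b * PU U) by ring) ((bS hb).mul (bPU hU))
    have : ln (star a) ≠ n + 2 := fun e => hab (eq_of ha e hb hbk)
    omega
  have hd : ∀ v, v ∈ U → S b * S v = S b * S a ∨ ∃ g, g ∈ S b * S v ∧ ln g = 1 ∧ ln (star g) = n + 1 := by
    intro v hv
    obtain ⟨U', rfl⟩ := Multiset.exists_cons_of_mem hv
    rw [Multiset.card_cons] at hUc
    have hU' : Arc U' := fun w hw => hU w (by simp [hw])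
    rw [PU_cons, show S b * S a * (S v * PU U') = S b * S v * (S a * PU U') by ring] at h2
    have hB : Bd (S a * PU U') (n+1) := by
      have := (bS ha).mul (bPU hU'); rwa [show 1 + Multiset.card U' = n + 1 by omega] at this
    obtain ⟨g, q1, q2, q3, q4⟩ := dich hb hbk (by omega) (hU v hv) hB h2
    rcases q4 with q4 | q4
    · exact Or.inr ⟨g, q1, q4, q3⟩
    · have : g = h := eq_of q4 q3 hh2 hhk'
      subst this; exact Or.inl (L1 q1 hh)
  have e1 : S b * S a * PU U = S a * (S b * PU U) := by ring
  by_cases hall : ∀ v, v ∈ U → S b * S v = S b * S a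
  · exfalso
    rw [e1, repl1 hall, hUc, show S a * (S b * S a ^ (n+1)) = S b * S a ^ (n+2) by ring] at h2
    exact caseA IH hb hbk ha hak hh2 hh h2
  push Not at hall
  obtain ⟨s, hs, hne⟩ := hall
  obtain ⟨c, hcs, hc, hck⟩ := (hd s hs).resolve_left hne
  obtain ⟨i, j, hij, he, hj⟩ := repl (b := b) (a := a) (s := s) (U := U) (by
    intro v hv
    rcases hd v hv with h | ⟨g, q1, q2, q3⟩
    · exact Or.inl h
    · right
      have : g = c := eq_of q2 q3 hc hck
      subst this; exact L1 q1 hcs)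
  have hj1 := hj ⟨s, hs, rfl⟩ hne
  obtain ⟨l, rfl⟩ : ∃ l, j = l + 1 := ⟨j - 1, by omega⟩
  rw [e1, he, show S a * (S b * S a ^ i * S s ^ (l+1)) = S b * S a ^ (i+1) * S s ^ (l+1) by ring] at h2
  exact caseB IH hb hbk ha hak hh2 hhk' hh (hU s hs) hc hck hcs hne (by omega) h2

theorem purity {n : ℕ} {a b : T} (hb : ln b = 1) (hbk : ln (star b) = n + 2) (ha : ln a = 1)
    (hak : ln (star a) = n + 1) (hab : a ∈ S b * S b) {W : Multiset T} (hW : Arc W)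
    (haW : a ∈ W) (hWc : Multiset.card W = n + 2) (h0 : e0 ∈ PU W) : ∀ t, t ∈ W → t = a := by
  obtain ⟨W', rfl⟩ := Multiset.exists_cons_of_mem haW
  intro t ht
  rcases Multiset.mem_cons.1 ht with h | ht'
  · exact h
  obtain ⟨W, rfl⟩ := Multiset.exists_cons_of_mem ht'
  have hW' : Arc W := fun w hw => hW w (by simp [hw])
  have ht1 : ln t = 1 := hW t ht
  simp only [Multiset.card_cons] at hWc
  rw [PU_cons, PU_cons] at h0
  have htb : t ≠ b := by
    rintro rfl
    have := circE h0 (show _ = S t * (S a * PU W) by ring) ((bS ha).mul (bPU hW')); omega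
  have h1 := mul_subl (S_sub hab) _ _ h0
  rw [show S b * S b * (S t * PU W) = S b * S t * (S b * PU W) by ring] at h1
  have hB : Bd (S b * PU W) (n+1) := by
    have := (bS hb).mul (bPU hW'); rwa [show 1 + Multiset.card W = n + 1 by omega] at this
  obtain ⟨g, q1, q2, q3, q4⟩ := dich hb hbk (by omega) ht1 hB h1
  rcases q4 with q4 | q4
  · have : g = a := eq_of q4 q3 ha hak
    subst this
    rw [show S b * S t * (S b * PU W) = S b * S t * S b * PU W by ring, R q1] at h1
    have := circE h1 (show _ = S b * (S g * PU W) by ring) ((bS ha).mul (bPU hW')); omega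
  · obtain ⟨w1, -, -⟩ := main (n+2) b t g hb hbk ht1 htb q4 (by omega) q1
    exact eq_of ht1 (show _ = n + 1 by omega) ha hak
end Hy

namespace Inst

variable {W : Type*} [Fintype W] (G : CTWDR W)

theorem walk_spec (x y : W) : HasWalk G.adj x y (ddist G.adj x y) :=
  Nat.sInf_mem (s := {n | HasWalk G.adj x y n}) (G.strong x y)

theorem dle {x y : W} {n : ℕ} (h : HasWalk G.adj x y n) : ddist G.adj x y ≤ n := Nat.sInf_le h

theorem dself (x : W) : ddist G.adj x x = 0 := by
  have := dle G (x := x) (y := x) (n := 0) ⟨fun _ => x, rfl, rfl, fun i hi => by omega⟩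
  omega

theorem deq {x y : W} (h : ddist G.adj x y = 0) : x = y := by
  obtain ⟨f, h1, h2, -⟩ := walk_spec G x y
  rw [h] at h2; rw [← h1, h2]

theorem dtri (x y z : W) : ddist G.adj x z ≤ ddist G.adj x y + ddist G.adj y z := by
  obtain ⟨f, f1, f2, f3⟩ := walk_spec G x y
  obtain ⟨g, g1, g2, g3⟩ := walk_spec G y z
  set n := ddist G.adj x y
  apply dle
  refine ⟨fun i => if i ≤ n then f i else g (i - n), by simp [f1], ?_, ?_⟩
  · by_cases h : ddist G.adj y z = 0
    · simp [h, f2]; exact deq G h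
    · have : ¬ (n + ddist G.adj y z ≤ n) := by omega
      simp only [this, if_false, Nat.add_sub_cancel_left, g2]
  · intro i hi
    beta_reduce
    rcases Nat.lt_trichotomy i n with h | h | h
    · rw [if_pos (by omega), if_pos (by omega)]; exact f3 i h
    · rw [if_pos (by omega), if_neg (by omega)]
      have e : f i = g 0 := by rw [h, f2, g1]
      rw [e, show i + 1 - n = 0 + 1 by omega]; exact g3 0 (by omega)
    · rw [if_neg (by omega), if_neg (by omega), show i + 1 - n = (i - n) + 1 by omega]
      exact g3 _ (by omega)

theorem dadj {x y : W} (h : G.adj x y) : ddist G.adj x y = 1 := by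
  have h1 := dle G (x := x) (y := y) (n := 1)
    ⟨fun i => if i = 0 then x else y, by simp, by simp, fun i hi => by
      have : i = 0 := by omega
      subst this; simpa using h⟩
  have h2 : ddist G.adj x y ≠ 0 := fun h0 => by
    have := deq G h0; subst this; exact G.loopless _ h
  omega

theorem dpath {x y : W} {n : ℕ} (h : ddist G.adj x y = n + 1) :
    ∃ z, ddist G.adj x z = 1 ∧ ddist G.adj z y = n := by
  obtain ⟨f, f1, f2, f3⟩ := walk_spec G x y
  rw [h] at f2 f3
  have h1 : ddist G.adj x (f 1) = 1 := by
    apply dadj; rw [← f1]; exact f3 0 (by omega)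
  refine ⟨f 1, h1, ?_⟩
  have h2 : ddist G.adj (f 1) y ≤ n := dle G ⟨fun i => f (i+1), rfl, f2, fun i hi => f3 _ (by omega)⟩
  have := dtri G x (f 1) y
  omega

theorem tswap {x y : W} {i : ℕ × ℕ} (h : tdist G.adj x y = i) : tdist G.adj y x = i.swap := by
  rw [← h]; rfl

theorem pnum_eq {x y : W} {h i j : ℕ × ℕ} (hh : tdist G.adj x y = h) :
    pnum G.adj h i j = Set.ncard {z : W | tdist G.adj x z = i ∧ tdist G.adj z y = j} := by
  unfold pnum
  have : {n | ∃ x y : W, tdist G.adj x y = h ∧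
    n = Set.ncard {z : W | tdist G.adj x z = i ∧ tdist G.adj z y = j}}
      = {Set.ncard {z : W | tdist G.adj x z = i ∧ tdist G.adj z y = j}} := by
    ext n
    simp only [Set.mem_setOf_eq, Set.mem_singleton_iff]
    constructor
    · rintro ⟨x', y', h1, rfl⟩
      exact G.wdr i j _ _ _ _ (h1.trans hh.symm)
    · rintro rfl; exact ⟨x, y, hh, rfl⟩
  rw [this, csSup_singleton]

theorem ncard_ne {A : Set W} {z : W} (h : z ∈ A) : A.ncard ≠ 0 := by
  rw [Ne, Set.ncard_eq_zero (Set.toFinite A)]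
  rintro rfl; exact h

theorem pnum_ne {h i j : ℕ × ℕ} (hp : pnum G.adj h i j ≠ 0) :
    ∃ x z y, tdist G.adj x z = i ∧ tdist G.adj z y = j ∧ tdist G.adj x y = h := by
  by_cases ha : ∃ x y, tdist G.adj x y = h
  · obtain ⟨x, y, hxy⟩ := ha
    rw [pnum_eq G hxy] at hp
    obtain ⟨z, h1, h2⟩ := Set.nonempty_of_ncard_ne_zero hp
    exact ⟨x, z, y, h1, h2, hxy⟩
  · exfalso; apply hp
    unfold pnum
    have : {n | ∃ x y : W, tdist G.adj x y = h ∧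
      n = Set.ncard {z : W | tdist G.adj x z = i ∧ tdist G.adj z y = j}} = ∅ := by
      ext n; simp only [Set.mem_setOf_eq, Set.mem_empty_iff_false, iff_false]
      rintro ⟨x, y, h1, -⟩; exact ha ⟨x, y, h1⟩
    rw [this]; simp

def mm (i j h : ℕ × ℕ) : Prop :=
  ∃ x z y, tdist G.adj x z = i ∧ tdist G.adj z y = j ∧ tdist G.adj x y = h

theorem m_any {i j h : ℕ × ℕ} (hm : mm G i j h) {x y : W} (hxy : tdist G.adj x y = h) :
    ∃ z, tdist G.adj x z = i ∧ tdist G.adj z y = j := by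
  obtain ⟨x', z', y', h1, h2, h3⟩ := hm
  have := G.wdr i j x' y' x y (h3.trans hxy.symm)
  have hne := ncard_ne (A := {z : W | tdist G.adj x' z = i ∧ tdist G.adj z y' = j}) ⟨h1, h2⟩
  rw [this] at hne
  exact Set.nonempty_of_ncard_ne_zero hne

theorem tself (x : W) : tdist G.adj x x = (0, 0) := by simp [tdist, dself]

def TT : Type := {i : ℕ × ℕ // Attained G.adj i}

instance : Finite (TT G) := by
  apply Finite.of_surjective (fun p : W × W => (⟨tdist G.adj p.1 p.2, _, _, rfl⟩ : TT G))
  rintro ⟨i, x, y, h⟩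
  exact ⟨(x, y), Subtype.ext h⟩

instance [Nonempty W] : Hy (TT G) where
  m i j h := mm G i.1 j.1 h.1
  star i := ⟨i.1.swap, by obtain ⟨i, x, y, h⟩ := i; exact ⟨y, x, tswap G h⟩⟩
  e0 := ⟨(0, 0), by obtain ⟨x⟩ := ‹Nonempty W›; exact ⟨x, x, tself G x⟩⟩
  ln i := i.1.1
  m_comm := by
    rintro i j h ⟨x, z, y, h1, h2, h3⟩
    have hne := ncard_ne (A := {z : W | tdist G.adj x z = i.1 ∧ tdist G.adj z y = j.1}) ⟨h1, h2⟩
    rw [G.comm] at hne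
    obtain ⟨w, w1, w2⟩ := Set.nonempty_of_ncard_ne_zero hne
    exact ⟨x, w, y, w1, w2, h3⟩
  m_assoc := by
    rintro i j k g h h1 ⟨x, z, y, h2, h3, h4⟩
    obtain ⟨w, w1, w2⟩ := m_any G h1 h2
    exact ⟨⟨tdist G.adj w y, w, y, rfl⟩, ⟨w, z, y, w2, h3, rfl⟩, ⟨x, w, y, w1, rfl, h4⟩⟩
  m_one := by
    intro i h; constructor
    · rintro ⟨x, z, y, h1, h2, h3⟩
      have : x = z := deq G (congrArg Prod.fst h1)
      subst this
      exact Subtype.ext (h3.symm.trans h2)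
    · rintro rfl
      obtain ⟨h, x, y, hh⟩ := h
      exact ⟨x, x, y, tself G x, hh, hh⟩
  m_inv := by
    rintro i j h ⟨x, z, y, h1, h2, h3⟩
    exact ⟨z, x, y, tswap G h1, h3, h2⟩
  m_star := by
    rintro i j h ⟨x, z, y, h1, h2, h3⟩
    have hne := ncard_ne (A := {z : W | tdist G.adj x z = i.1 ∧ tdist G.adj z y = j.1}) ⟨h1, h2⟩
    rw [G.comm] at hne
    obtain ⟨w, w1, w2⟩ := Set.nonempty_of_ncard_ne_zero hne
    exact ⟨y, w, x, tswap G w2, tswap G w1, tswap G h3⟩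
  star_star := by intro i; rfl
  m_e0 := by
    rintro ⟨i, x, y, h⟩
    exact ⟨x, y, x, h, tswap G h, tself G x⟩
  m_e0' := by
    rintro i j ⟨x, z, y, h1, h2, h3⟩
    have : x = y := deq G (congrArg Prod.fst h3)
    subst this
    exact Subtype.ext (h2.symm.trans (tswap G h1))
  m_ne := by
    rintro ⟨i, x, z, h1⟩ ⟨j, u, v, h2⟩
    obtain ⟨y, y1, y2⟩ := m_any G (i := j) (j := j.swap) (h := (0,0))
      ⟨u, v, u, h2, tswap G h2, tself G u⟩ (tself G z)
    exact ⟨⟨tdist G.adj x y, x, y, rfl⟩, x, z, y, h1, y1, rfl⟩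
  thick := by
    rintro i k h hm ⟨x, y, z, h1, h2, h3⟩
    obtain ⟨w, w1, w2⟩ := m_any G hm h1
    have hA := ncard_ne (A := {w : W | tdist G.adj x w = i.1 ∧ tdist G.adj w y = i.1.swap}) ⟨w1, w2⟩
    have e1 := pnum_eq G (i := i.1) (j := i.1.swap) h1
    have e2 : kval G.adj i.1 = _ := pnum_eq G (i := i.1) (j := i.1.swap) (tself G y)
    have e3 := ((G.thick k.1 i.1).2).resolve_left (by rw [e1]; exact hA)
    rw [e1, e2] at e3
    have hsub : {w : W | tdist G.adj x w = i.1 ∧ tdist G.adj w y = i.1.swap} ⊆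
        {w : W | tdist G.adj y w = i.1 ∧ tdist G.adj w y = i.1.swap} := by
      rintro w ⟨-, h⟩; exact ⟨by have := tswap G h; simpa using this, h⟩
    have e4 := Set.eq_of_subset_of_ncard_le hsub e3.ge (Set.toFinite _)
    have : z ∈ {w : W | tdist G.adj y w = i.1 ∧ tdist G.adj w y = i.1.swap} := ⟨h2, tswap G h2⟩
    rw [← e4] at this
    exact Subtype.ext (h3.symm.trans this.1)
  ln_inj := by
    intro i j h1 h2
    exact Subtype.ext (Prod.ext h1 h2)
  ln_zero := by
    rintro ⟨i, x, y, h⟩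
    constructor
    · intro h0
      have : x = y := deq G ((congrArg Prod.fst h).trans h0)
      subst this
      exact Subtype.ext (h.symm.trans (tself G x))
    · intro h0; exact congrArg (fun t => t.1.1) h0
  ln_tri := by
    rintro i j h ⟨x, z, y, h1, h2, h3⟩
    rw [← h1, ← h2, ← h3]; exact dtri G x z y
  ln_path := by
    rintro ⟨i, x, y, h⟩ n hn
    obtain ⟨z, z1, z2⟩ := dpath G (x := x) (y := y) (n := n) ((congrArg Prod.fst h).trans hn)
    exact ⟨⟨tdist G.adj x z, x, z, rfl⟩, ⟨tdist G.adj z y, z, y, rfl⟩, z1, z2, x, z, y, rfl, rfl, h⟩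

noncomputable def ty (x y : W) : TT G := ⟨tdist G.adj x y, x, y, rfl⟩

open Hy

theorem ty_mul [Nonempty W] (x z y : W) : ty G x y ∈ S (ty G x z) * S (ty G z y) :=
  ⟨_, rfl, _, rfl, x, z, y, rfl, rfl, rfl⟩

theorem ty_self [Nonempty W] (x : W) : ty G x x = e0 := Subtype.ext (tself G x)

theorem ty_path [Nonempty W] (f : ℕ → W) (n : ℕ) :
    ty G (f 0) (f n) ∈ PU ((Multiset.range n).map fun i => ty G (f i) (f (i+1))) := by
  induction n with
  | zero => simp only [Multiset.range_zero, Multiset.map_zero]; rw [PU_zero, mem_one, ty_self]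
  | succ n ih =>
    rw [Multiset.range_succ, Multiset.map_cons, PU_cons, mul_comm]
    exact mul_subl (S_sub ih) _ _ (ty_mul G _ _ _)

end Inst

open Hy Inst in
/-- Lemma 4.1: if `p^{(2,q-2)}_{(1,p-1),(1,q-1)} ≠ 0` with `q ≠ p`,
then `C(q)` exists and `p = q - 1`. -/
theorem stmt11 {V : Type*} [Fintype V] (G : CTWDR V) (p q : ℕ) (hpq : q ≠ p)
    (h : pnum G.adj (2, q - 2) (1, p - 1) (1, q - 1) ≠ 0) :
    G.Cexists q ∧ p = q - 1 := by
  obtain ⟨x, z, y, h1, h2, h3⟩ := pnum_ne G h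
  haveI : Nonempty V := ⟨x⟩
  have key : ∀ u v : V, ∀ i j, tdist G.adj u v = (i + 1, j) → j ≠ 0 := by
    intro u v i j he h0
    have e1 : ddist G.adj v u = j := congrArg Prod.snd he
    have e2 : ddist G.adj u v = i + 1 := congrArg Prod.fst he
    have := deq G (e1.trans h0)
    subst this
    rw [dself] at e2; omega
  have k1 := key _ _ _ _ h1
  have k2 := key _ _ _ _ h2
  have k3 := key _ _ _ _ h3
  obtain ⟨n, rfl⟩ : ∃ n, q = n + 3 := ⟨q - 3, by omega⟩
  have hm : ty G x y ∈ S (ty G z y) * S (ty G x z) := by rw [mul_comm]; exact ty_mul G x z y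
  have lnE : ∀ u v : V, ln (ty G u v) = (tdist G.adj u v).1 := fun _ _ => rfl
  have lsE : ∀ u v : V, ln (star (ty G u v)) = (tdist G.adj u v).2 := fun _ _ => rfl
  have b1 : ln (ty G z y) = 1 := by rw [lnE, h2]
  have b2 : ln (star (ty G z y)) = n + 2 := by rw [lsE, h2]; simp
  have a1 : ln (ty G x z) = 1 := by rw [lnE, h1]
  have a2 : ln (star (ty G x z)) = p - 1 := by rw [lsE, h1]
  obtain ⟨w1, w2, w3⟩ := main (n+2) (ty G z y) (ty G x z) (ty G x y) b1 b2 a1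
    (ne_of_star (by omega)) (by rw [lnE, h3]) (by rw [lsE, h3]; simp) hm
  have hp : p = n + 2 := by omega
  subst hp
  refine ⟨⟨?_, ?_⟩, by omega⟩
  · obtain ⟨i, hi, j, hj, hmm⟩ := w2
    rw [mem_S] at hi hj; subst hi hj
    obtain ⟨u, u1, u2⟩ := m_any G hmm (x := x) (y := z) rfl
    rw [pnum_eq G (x := x) (y := z) (by rw [h1]; rfl)]
    exact ncard_ne (z := u) ⟨u1.trans h2, u2.trans h2⟩
  · intro f hf
    rintro ⟨i, hi, hfi⟩ j hj
    obtain ⟨-, f1, f2⟩ := hf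
    simp only [Nat.add_one_sub_one, show n + 3 - 1 = n + 2 by omega] at *
    have e0f := ty_path G f (n+2)
    rw [f1, ty_self] at e0f
    have ha : ty G (f i) (f (i+1)) = ty G x z := Subtype.ext (hfi.trans h1.symm)
    have := purity b1 b2 a1 (show _ = n + 1 by omega) w2
      (W := (Multiset.range (n+2)).map fun i => ty G (f i) (f (i+1)))
      (by
        intro v hv
        obtain ⟨r, hr, rfl⟩ := Multiset.mem_map.1 hv
        exact dadj G (f2 r (Multiset.mem_range.1 hr)))
      (Multiset.mem_map.2 ⟨i, Multiset.mem_range.2 hi, ha⟩) (by simp) e0f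
      (ty G (f j) (f (j+1))) (Multiset.mem_map.2 ⟨j, Multiset.mem_range.2 hj, rfl⟩)
    exact (congrArg Subtype.val this).trans h1
end

section
/- Let Γ be a commutative thick weakly distance-regular digraph with q ≠ p such that Γ_{1,p-1}^2 ∩ Γ_{1,q-1}Γ_{q-1,1} ≠ ∅, Γ_{1,p-1} ∉ Γ_{1,q-1}Γ_{q-1,1}, and (1,q-1) is pure. Then Γ_{1,p-1}Γ_{1,q-1} = {Γ_{2,q}}. -/
/-!
Common framework: commutative thick weakly distance-regular digraphs.
-/

variable {V : Type*}

section aux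
variable {W : Type*}

theorem ddist_le {adj : W → W → Prop} {x y : W} {n : ℕ} (h : HasWalk adj x y n) :
    ddist adj x y ≤ n := Nat.sInf_le h

theorem walk_trans {adj : W → W → Prop} {x y z : W} {m n : ℕ} (h : HasWalk adj x y m)
    (h' : HasWalk adj y z n) : HasWalk adj x z (m + n) := by
  obtain ⟨f, f0, fm, hf⟩ := h
  obtain ⟨g, g0, gn, hg⟩ := h'
  refine ⟨fun i => if i < m then f i else g (i - m), ?_, ?_, ?_⟩
  · by_cases hm : 0 < m
    · simp [hm, f0]
    · have : m = 0 := by omega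
      subst this
      simp [g0, ← fm, f0]
  · simp [gn]
  · intro i hi
    by_cases h1 : i + 1 < m
    · have h2 : i < m := by omega
      simp only [h1, h2, if_true]
      exact hf i h2
    · by_cases h2 : i < m
      · have h3 : i + 1 = m := by omega
        have h4 := hf i h2
        rw [h3, fm] at h4
        simp only [h1, h2, if_true, if_false]
        have : i + 1 - m = 0 := by omega
        rw [this, g0]
        exact h4
      · simp only [h1, h2, if_false]
        have h5 := hg (i - m) (by omega)
        have : i + 1 - m = i - m + 1 := by omega
        rw [this]
        exact h5

theorem walk_one {adj : W → W → Prop} {x y : W} (h : adj x y) : HasWalk adj x y 1 := by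
  refine ⟨fun i => if i = 0 then x else y, by simp, by simp, ?_⟩
  intro i hi
  have : i = 0 := by omega
  subst this
  simpa using h

theorem walk_sub {adj : W → W → Prop} {f : ℕ → W} {n : ℕ} (h : ∀ i < n, adj (f i) (f (i + 1)))
    (i k : ℕ) (hk : i + k ≤ n) : HasWalk adj (f i) (f (i + k)) k :=
  ⟨fun j => f (i + j), by simp, rfl, fun j hj => h (i + j) (by omega)⟩

end aux

namespace CTWDR
variable {W : Type*} [Fintype W] (G : CTWDR W)

theorem walk_ddist (x y : W) : HasWalk G.adj x y (ddist G.adj x y) :=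
  Nat.sInf_mem (G.strong x y)

theorem tri (x y z : W) : ddist G.adj x z ≤ ddist G.adj x y + ddist G.adj y z :=
  ddist_le (walk_trans (G.walk_ddist x y) (G.walk_ddist y z))

theorem dself (x : W) : ddist G.adj x x = 0 :=
  Nat.le_zero.mp (ddist_le ⟨fun _ => x, rfl, rfl, fun i hi => by omega⟩)

theorem deq {x y : W} (h : ddist G.adj x y = 0) : x = y := by
  have h1 := G.walk_ddist x y
  rw [h] at h1
  obtain ⟨f, f0, f1, _⟩ := h1
  rw [← f0, f1]

theorem dstep {x y : W} {n : ℕ} (h : ddist G.adj x y = n + 1) :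
    ∃ z, G.adj x z ∧ ddist G.adj z y ≤ n := by
  have h1 := G.walk_ddist x y
  rw [h] at h1
  obtain ⟨f, f0, f1, hf⟩ := h1
  refine ⟨f 1, ?_, ?_⟩
  · have := hf 0 (by omega)
    rwa [f0] at this
  · have := walk_sub hf 1 n (by omega)
    rw [Nat.add_comm 1 n, f1] at this
    exact ddist_le this

theorem dadj {x y : W} (h : ddist G.adj x y = 1) : G.adj x y := by
  obtain ⟨z, hz, h2⟩ := G.dstep (n := 0) h
  have := G.deq (Nat.le_zero.mp h2)
  rwa [this] at hz

theorem adjd {x y : W} (h : G.adj x y) : ddist G.adj x y = 1 := by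
  have h1 := ddist_le (walk_one h)
  have h2 : ddist G.adj x y ≠ 0 := by
    intro h0
    have := G.deq h0
    subst this
    exact G.loopless _ h
  omega

theorem tswap {x y : W} {i : ℕ × ℕ} (h : tdist G.adj x y = i) : tdist G.adj y x = i.swap := by
  subst h; rfl

theorem tswap' {x y : W} {i : ℕ × ℕ} (h : tdist G.adj x y = i.swap) : tdist G.adj y x = i := by
  have := G.tswap h
  simpa using this

theorem transfer {x y z x' y' : W} (h : tdist G.adj x' y' = tdist G.adj x y) :
    ∃ z', tdist G.adj x' z' = tdist G.adj x z ∧ tdist G.adj z' y' = tdist G.adj z y := by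
  have h1 := G.wdr (tdist G.adj x z) (tdist G.adj z y) x y x' y' h.symm
  have h2 : Set.ncard {t : W | tdist G.adj x t = tdist G.adj x z ∧
      tdist G.adj t y = tdist G.adj z y} ≠ 0 := by
    intro h0
    rw [Set.ncard_eq_zero (Set.toFinite _)] at h0
    have : z ∈ (∅ : Set W) := h0 ▸ (⟨rfl, rfl⟩ : z ∈ {t : W | tdist G.adj x t = tdist G.adj x z ∧
      tdist G.adj t y = tdist G.adj z y})
    exact this
  rw [h1] at h2
  obtain ⟨z', hz⟩ := Set.nonempty_of_ncard_ne_zero h2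
  exact ⟨z', hz⟩

theorem exch (x z y : W) :
    ∃ z', tdist G.adj x z' = tdist G.adj z y ∧ tdist G.adj z' y = tdist G.adj x z := by
  have h1 := G.comm (tdist G.adj x z) (tdist G.adj z y) x y
  have h2 : Set.ncard {t : W | tdist G.adj x t = tdist G.adj x z ∧
      tdist G.adj t y = tdist G.adj z y} ≠ 0 := by
    intro h0
    rw [Set.ncard_eq_zero (Set.toFinite _)] at h0
    have : z ∈ (∅ : Set W) := h0 ▸ (⟨rfl, rfl⟩ : z ∈ {t : W | tdist G.adj x t = tdist G.adj x z ∧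
      tdist G.adj t y = tdist G.adj z y})
    exact this
  rw [h1] at h2
  obtain ⟨z', hz⟩ := Set.nonempty_of_ncard_ne_zero h2
  exact ⟨z', hz⟩

theorem pnum_eq (x y : W) (i j : ℕ × ℕ) : pnum G.adj (tdist G.adj x y) i j =
    Set.ncard {z : W | tdist G.adj x z = i ∧ tdist G.adj z y = j} := by
  unfold pnum
  have : {n | ∃ x' y' : W, tdist G.adj x' y' = tdist G.adj x y ∧
    n = Set.ncard {z : W | tdist G.adj x' z = i ∧ tdist G.adj z y' = j}} =
    {Set.ncard {z : W | tdist G.adj x z = i ∧ tdist G.adj z y = j}} := by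
    ext n
    constructor
    · rintro ⟨x', y', h, rfl⟩
      exact G.wdr i j x' y' x y h
    · intro h
      exact ⟨x, y, rfl, h⟩
  rw [this, csSup_singleton]

theorem pnum_ne {h i j : ℕ × ℕ} (hh : pnum G.adj h i j ≠ 0) :
    ∃ x y z, tdist G.adj x y = h ∧ tdist G.adj x z = i ∧ tdist G.adj z y = j := by
  by_cases ha : ∃ x y, tdist G.adj x y = h
  · obtain ⟨x, y, rfl⟩ := ha
    rw [pnum_eq] at hh
    obtain ⟨z, hz⟩ := Set.nonempty_of_ncard_ne_zero hh
    exact ⟨x, y, z, rfl, hz.1, hz.2⟩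
  · exfalso
    apply hh
    unfold pnum
    have : {n | ∃ x' y' : W, tdist G.adj x' y' = h ∧
      n = Set.ncard {z : W | tdist G.adj x' z = i ∧ tdist G.adj z y' = j}} = ∅ := by
      ext n
      simp only [Set.mem_setOf_eq, Set.mem_empty_iff_false, iff_false]
      rintro ⟨x, y, h1, _⟩
      exact ha ⟨x, y, h1⟩
    rw [this]
    exact csSup_empty

theorem ne_pnum {x y z : W} {i j : ℕ × ℕ} (h1 : tdist G.adj x z = i) (h2 : tdist G.adj z y = j) :
    pnum G.adj (tdist G.adj x y) i j ≠ 0 := by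
  rw [pnum_eq]
  intro h0
  rw [Set.ncard_eq_zero (Set.toFinite _)] at h0
  have : z ∈ (∅ : Set W) := h0 ▸ (⟨h1, h2⟩ : z ∈ {z : W | tdist G.adj x z = i ∧ tdist G.adj z y = j})
  exact this

theorem kval_eq (x : W) (i : ℕ × ℕ) : kval G.adj i = Set.ncard {z : W | tdist G.adj x z = i} := by
  unfold kval
  have h : tdist G.adj x x = (0, 0) := by simp [tdist, G.dself]
  rw [← h, pnum_eq]
  congr 1
  ext z
  constructor
  · intro h; exact h.1
  · intro h; exact ⟨h, G.tswap h⟩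

theorem full {x y : W} {i j : ℕ × ℕ} (hk : pnum G.adj (tdist G.adj x y) i j = kval G.adj i)
    {d : W} (hd : tdist G.adj x d = i) : tdist G.adj d y = j := by
  rw [pnum_eq, G.kval_eq x] at hk
  have h1 : {z : W | tdist G.adj x z = i ∧ tdist G.adj z y = j} = {z : W | tdist G.adj x z = i} :=
    Set.eq_of_subset_of_ncard_le (fun z hz => hz.1) hk.ge (Set.toFinite _)
  have h2 : d ∈ {z : W | tdist G.adj x z = i ∧ tdist G.adj z y = j} := by
    rw [h1]; exact hd
  exact h2.2

/-- common out-neighbour implies equal out-neighbourhoods -/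
theorem tw {i : ℕ × ℕ} {x y c d : W} (h1 : tdist G.adj x c = i) (h2 : tdist G.adj y c = i)
    (h3 : tdist G.adj x d = i) : tdist G.adj y d = i := by
  have h4 := G.ne_pnum h1 (G.tswap h2)
  exact G.tswap' (G.full ((G.thick _ i).2.resolve_left h4) h3)

/-- common in-neighbour implies equal in-neighbourhoods -/
theorem twi {i : ℕ × ℕ} {x y c d : W} (h1 : tdist G.adj c x = i) (h2 : tdist G.adj c y = i)
    (h3 : tdist G.adj d x = i) : tdist G.adj d y = i :=
  G.tswap' (G.tw (G.tswap h1) (G.tswap h2) (G.tswap h3))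

/-- common in-neighbour yields common out-neighbour -/
theorem io {i : ℕ × ℕ} {x y c : W} (h1 : tdist G.adj c x = i) (h2 : tdist G.adj c y = i) :
    ∃ d, tdist G.adj x d = i ∧ tdist G.adj y d = i := by
  obtain ⟨d, hd, hd'⟩ := G.exch x c y
  exact ⟨d, hd.trans h2, G.tswap' (hd'.trans (G.tswap h1))⟩

theorem oi {i : ℕ × ℕ} {x y c : W} (h1 : tdist G.adj x c = i) (h2 : tdist G.adj y c = i) :
    ∃ d, tdist G.adj d x = i ∧ tdist G.adj d y = i := by
  obtain ⟨d, hd, hd'⟩ := G.exch x c y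
  exact ⟨d, G.tswap' (hd.trans (G.tswap h2)), hd'.trans h1⟩

theorem ex_out {i : ℕ × ℕ} (ha : Attained G.adj i) (x : W) : ∃ y, tdist G.adj x y = i := by
  obtain ⟨a, b, h⟩ := ha
  obtain ⟨z, hz, _⟩ := G.transfer (x := a) (y := a) (z := b) (x' := x) (y' := x)
    (by simp [tdist, G.dself])
  exact ⟨z, hz.trans h⟩

theorem ex_in {i : ℕ × ℕ} (ha : Attained G.adj i) (x : W) : ∃ y, tdist G.adj y x = i := by
  obtain ⟨a, b, h⟩ := ha
  obtain ⟨z, _, hz⟩ := G.transfer (x := b) (y := b) (z := a) (x' := x) (y' := x)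
    (by simp [tdist, G.dself])
  exact ⟨z, hz.trans h⟩

theorem pos {x y : W} {s : ℕ} (h : tdist G.adj x y = (1, s - 1)) : 2 ≤ s := by
  by_contra hs
  have h1 : ddist G.adj x y = 1 := congrArg Prod.fst h
  have h2 : ddist G.adj y x = s - 1 := congrArg Prod.snd h
  have h3 : ddist G.adj y x = 0 := by omega
  rw [G.deq h3, G.dself] at h1
  omega

/-- bundled hypotheses -/
structure Hyp (G : CTWDR W) (p q : ℕ) : Prop where
  hpq : q ≠ p
  hp : Attained G.adj (1, p - 1)
  hq : Attained G.adj (1, q - 1)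
  hcap : ∃ x y c e, tdist G.adj x c = (1, p - 1) ∧ tdist G.adj c y = (1, p - 1) ∧
    tdist G.adj x e = (1, q - 1) ∧ tdist G.adj y e = (1, q - 1)
  hnot : ∀ x y e, tdist G.adj x y = (1, p - 1) → tdist G.adj x e = (1, q - 1) →
    tdist G.adj y e = (1, q - 1) → False
  hpure : G.Pure q

def Ar (s : ℕ) (x y : W) : Prop := tdist G.adj x y = (1, s - 1)

def Tw (q : ℕ) (x y : W) : Prop := ∃ c, G.Ar q x c ∧ G.Ar q y c

def Lr (p q : ℕ) (x y : W) : Prop := ∃ z, G.Ar p x z ∧ G.Tw q z y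

def BW (q : ℕ) : ℕ → W → W → Prop
  | 0, x, y => x = y
  | n + 1, x, y => ∃ z, BW q n x z ∧ G.Ar q z y

variable {G}

theorem Ar.d {s : ℕ} {x y : W} (h : G.Ar s x y) : ddist G.adj x y = 1 := congrArg Prod.fst h
theorem Ar.d' {s : ℕ} {x y : W} (h : G.Ar s x y) : ddist G.adj y x = s - 1 := congrArg Prod.snd h
theorem Ar.adj {s : ℕ} {x y : W} (h : G.Ar s x y) : G.adj x y := G.dadj h.d

theorem Tw.out {q : ℕ} {x y d : W} (h : G.Tw q x y) (hd : G.Ar q x d) : G.Ar q y d := by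
  obtain ⟨c, h1, h2⟩ := h
  exact G.tw h1 h2 hd

theorem Tw.inn {q : ℕ} {x y d : W} (h : G.Tw q x y) (hd : G.Ar q d x) : G.Ar q d y := by
  obtain ⟨c, h1, h2⟩ := h
  obtain ⟨e, h3, h4⟩ := G.oi h1 h2
  exact G.twi h3 h4 hd

theorem Tw.symm {q : ℕ} {x y : W} (h : G.Tw q x y) : G.Tw q y x := by
  obtain ⟨c, h1, h2⟩ := h
  exact ⟨c, h2, h1⟩

theorem Tw.trans {q : ℕ} {x y z : W} (h : G.Tw q x y) (h' : G.Tw q y z) : G.Tw q x z := by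
  obtain ⟨c, h1, h2⟩ := h
  exact ⟨c, h1, h'.out h2⟩

theorem Tw.of_in {q : ℕ} {x y c : W} (h1 : G.Ar q c x) (h2 : G.Ar q c y) : G.Tw q x y := G.io h1 h2

theorem Tw.cong {q : ℕ} {x y x' y' : W} (h : G.Tw q x y) (e : tdist G.adj x' y' = tdist G.adj x y) :
    G.Tw q x' y' := by
  obtain ⟨c, h1, h2⟩ := h
  obtain ⟨z, hz, hz'⟩ := G.transfer (z := c) e
  exact ⟨z, hz.trans h1, G.tswap' (hz'.trans (G.tswap h2))⟩

theorem Lr.cong {p q : ℕ} {x y x' y' : W} (h : G.Lr p q x y)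
    (e : tdist G.adj x' y' = tdist G.adj x y) : G.Lr p q x' y' := by
  obtain ⟨c, h1, h2⟩ := h
  obtain ⟨z, hz, hz'⟩ := G.transfer (z := c) e
  exact ⟨z, hz.trans h1, h2.cong hz'⟩

namespace Hyp
variable {p q : ℕ} (H : Hyp G p q)

theorem q2 (H : Hyp G p q) : 2 ≤ q := by
  obtain ⟨x, y, h⟩ := H.hq
  exact G.pos h

theorem p2 (H : Hyp G p q) : 2 ≤ p := by
  obtain ⟨x, y, h⟩ := H.hp
  exact G.pos h

theorem ne (H : Hyp G p q) {x y : W} (h : G.Ar p x y) (h' : G.Ar q x y) : False := by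
  have := h.d'
  have := h'.d'
  have := H.p2
  have := H.q2
  have := H.hpq
  omega

theorem rfl' (H : Hyp G p q) (x : W) : G.Tw q x x := by
  obtain ⟨y, h⟩ := G.ex_out H.hq x
  exact ⟨y, h, h⟩

theorem H1 (H : Hyp G p q) {u v : W} (h : G.Ar p u v) : ∃ y, G.Ar p v y ∧ G.Tw q u y := by
  obtain ⟨x, y, c, e, h1, h2, h3, h4⟩ := H.hcap
  obtain ⟨z, hz, hz'⟩ := G.transfer (x := x) (y := c) (z := y) (x' := u) (y' := v) (h.trans h1.symm)
  exact ⟨z, G.tswap' (hz'.trans (G.tswap h2)), Tw.cong ⟨e, h3, h4⟩ hz⟩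

theorem H2 (H : Hyp G p q) {u v : W} (h : G.Ar p u v) : ∃ x, G.Ar p x u ∧ G.Tw q x v := by
  obtain ⟨x, y, c, e, h1, h2, h3, h4⟩ := H.hcap
  obtain ⟨z, hz, hz'⟩ := G.transfer (x := c) (y := y) (z := x) (x' := u) (y' := v) (h.trans h2.symm)
  exact ⟨z, G.tswap' (hz.trans (G.tswap h1)), Tw.cong ⟨e, h3, h4⟩ hz'⟩

theorem P (H : Hyp G p q) {a b c d : W} (h : G.Ar q a b) (h' : G.adj c d)
    (hl : ddist G.adj b c + ddist G.adj d a + 2 ≤ q) : G.Ar q c d := by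
  have e1 := h.d'
  have e2 := G.tri b c a
  have e3 := G.tri c d a
  have e4 := G.adjd h'
  have w := walk_trans (walk_one h.adj) (walk_trans (G.walk_ddist b c)
    (walk_trans (walk_one h') (G.walk_ddist d a)))
  obtain ⟨f1, f10, f1m, hf1⟩ := G.walk_ddist b c
  obtain ⟨f2, f20, f2n, hf2⟩ := G.walk_ddist d a
  set m := ddist G.adj b c with hm
  set n := ddist G.adj d a with hn
  have hmn : m + n + 2 = q := by omega
  let f : ℕ → W := fun i => if i = 0 then a else if i ≤ m + 1 then f1 (i - 1) else f2 (i - m - 2)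
  have F0 : f 0 = a := rfl
  have F1 : ∀ j ≤ m, f (j + 1) = f1 j := by
    intro j hj
    have h1 : j + 1 ≤ m + 1 := by omega
    simp [f, hj]
  have F2 : ∀ j, f (j + m + 2) = f2 j := by
    intro j
    have h1 : ¬ (j + m + 2 ≤ m + 1) := by omega
    have h2 : j + m + 2 - m - 2 = j := by omega
    simp only [f, h1, if_false, h2]
    simp
  have hc : IsCircuit G.adj q f := by
    refine ⟨by omega, ?_, ?_⟩
    · rw [F0, ← f2n, ← F2]
      congr 1
      omega
    · intro i hi
      rcases Nat.eq_zero_or_pos i with h0 | h0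
      · subst h0
        rw [F0, F1 0 (by omega), f10]
        exact h.adj
      · obtain ⟨j, rfl⟩ : ∃ j, i = j + 1 := ⟨i - 1, by omega⟩
        rcases Nat.lt_trichotomy j m with h1 | h1 | h1
        · rw [F1 j h1.le, F1 (j + 1) h1]
          exact hf1 j h1
        · rw [h1]
          have h2 := F2 0
          rw [F1 m le_rfl, show m + 1 + 1 = 0 + m + 2 by omega, h2, f1m, f20]
          exact h'
        · obtain ⟨k, rfl⟩ : ∃ k, j = k + m + 1 := ⟨j - m - 1, by omega⟩
          rw [show k + m + 1 + 1 + 1 = (k + 1) + m + 2 by omega,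
            show k + m + 1 + 1 = k + m + 2 by omega, F2, F2]
          exact hf2 k (by omega)
  have h3 := H.hpure f hc ⟨0, by omega, by
    rw [F0, F1 0 (by omega), f10]; exact h⟩ (m + 1) (by omega)
  have h2 := F2 0
  rw [F1 m le_rfl, show m + 1 + 1 = 0 + m + 2 by omega, h2, f1m, f20] at h3
  exact h3

theorem Q (H : Hyp G p q) (hq : 3 ≤ q) {a b c : W} (h : G.Ar q a b) (h' : G.Ar q b c) :
    ∃ d, G.Ar q c d ∧ ddist G.adj d a ≤ q - 3 := by
  have e1 := h.d'
  obtain ⟨b1, hb1, hd1⟩ := G.dstep (n := q - 2) (x := b) (y := a) (by omega)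
  have e2 := G.tri b b1 a
  have e3 := G.adjd hb1
  obtain ⟨b2, hb2, hd2⟩ := G.dstep (n := q - 3) (x := b1) (y := a) (by omega)
  have s1 := H.P h hb1 (by rw [G.dself]; omega)
  have s2 := H.P h hb2 (by omega)
  exact ⟨b2, (Tw.of_in s1 h').out s2, hd2⟩

theorem caseC (H : Hyp G p q) {u v w : W} (h1 : G.Ar p u v) (h2 : G.Ar q v w)
    (h3 : tdist G.adj u w = (1, q)) : False := by
  have hq2 := H.q2
  obtain ⟨y, hy, hty⟩ := H.H1 h1
  obtain ⟨w1, hw1, hw1'⟩ := G.transfer (x := u) (y := v) (z := w) (x' := v) (y' := y)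
    (hy.trans h1.symm)
  have c1 : tdist G.adj v w1 = (1, q) := hw1.trans h3
  have b1 : G.Ar q y w1 := G.tswap' (hw1'.trans (G.tswap h2))
  have b2 : G.Ar q u w1 := hty.symm.out b1
  have duw : ddist G.adj u w = 1 := congrArg Prod.fst h3
  have dwu : ddist G.adj w u = q := congrArg Prod.snd h3
  by_cases hq : 3 ≤ q
  · obtain ⟨s, hs, hs'⟩ := G.exch w v w1
    have c2 : tdist G.adj w s = (1, q) := hs.trans c1
    have b3 : G.Ar q w1 s := G.tswap' (hs'.trans (G.tswap h2))
    obtain ⟨d, hd, hd'⟩ := H.Q hq b2 b3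
    have dws : ddist G.adj w s = 1 := congrArg Prod.fst c2
    have := (H.P hd (G.dadj duw) (by omega)).d'
    omega
  · have hq' : q = 2 := by omega
    have e1 : ddist G.adj v w1 = 1 := congrArg Prod.fst c1
    have e2 := b2.d'
    have e3 := G.tri v w1 u
    have e4 := h1.d'
    have e5 := H.p2
    have e6 := H.hpq
    have hp3 : p = 3 := by omega
    have a2 : G.Ar p u w := by
      unfold Ar
      rw [h3, hp3, hq']
    -- B-arcs are A-twins
    have key : ∀ {x z : W}, G.Ar q x z → ∃ e, G.Ar p e x ∧ G.Ar p e z := by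
      intro x z hxz
      obtain ⟨e, he, he'⟩ := G.transfer (x := v) (y := w) (z := u) (x' := x) (y' := z)
        (hxz.trans h2.symm)
      exact ⟨e, G.tswap' (he.trans (G.tswap h1)), he'.trans a2⟩
    obtain ⟨c, hc, hc'⟩ := hty
    obtain ⟨e, he, he'⟩ := key hc
    obtain ⟨g, hg, hg'⟩ := key hc'
    have s1 : G.Ar p v c := G.twi hg hg' hy
    have s2 : G.Ar p v u := G.twi he' he s1
    have := s2.d
    omega

theorem bounds (H : Hyp G p q) {u v w : W} (h1 : G.Ar p u v) (h2 : G.Ar q v w) :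
    tdist G.adj u w = (2, q - 1) ∨ tdist G.adj u w = (2, q) := by
  have hq2 := H.q2
  obtain ⟨x, hx, hxt⟩ := H.H2 h1
  have e1 := (hxt.symm.out h2).d'
  have e2 := G.tri w x u
  have e3 := hx.d
  have e4 := h2.d'
  have e5 := G.tri w u v
  have e6 := h1.d
  have e7 := G.tri u v w
  have e8 := h2.d
  have e9 : ddist G.adj w u ≠ q - 2 := by
    intro h
    exact H.ne h1 (H.P h2 h1.adj (by rw [G.dself]; omega))
  have e10 : ddist G.adj u w ≠ 0 := by
    intro h
    have := G.deq h
    subst this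
    have := G.dself u
    omega
  have e11 : ddist G.adj u w ≠ 1 := by
    intro h
    have : ddist G.adj w u = q - 1 ∨ ddist G.adj w u = q := by omega
    rcases this with h' | h'
    · exact H.hnot u v w h1 (by simp [tdist, h, h']) h2
    · exact H.caseC h1 h2 (by simp [tdist, h, h'])
  have e12 : ddist G.adj u w = 2 := by omega
  have : ddist G.adj w u = q - 1 ∨ ddist G.adj w u = q := by omega
  rcases this with h' | h'
  · left; simp [tdist, e12, h']
  · right; simp [tdist, e12, h']

theorem Lof (H : Hyp G p q) {x y : W} (h : G.Ar p x y) : G.Lr p q x y := ⟨y, h, H.rfl' y⟩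

theorem Lsymm (H : Hyp G p q) {x y : W} (h : G.Lr p q x y) : G.Lr p q y x := by
  obtain ⟨y', h1, h2⟩ := h
  obtain ⟨x', h3, h4⟩ := H.H1 h1
  obtain ⟨t, ht, ht'⟩ := G.exch y y' x'
  exact ⟨t, ht.trans h3, (h2.symm.cong ht').trans h4.symm⟩

theorem Ltw (H : Hyp G p q) {x y z : W} (h : G.Lr p q x y) (h' : G.Tw q y z) : G.Lr p q x z := by
  obtain ⟨y', h1, h2⟩ := h
  exact ⟨y', h1, h2.trans h'⟩

theorem twL (H : Hyp G p q) {x y z : W} (h' : G.Tw q z x) (h : G.Lr p q x y) : G.Lr p q z y :=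
  H.Lsymm (H.Ltw (H.Lsymm h) h'.symm)

theorem L3 (H : Hyp G p q) {x y z t : W} (h1 : G.Lr p q x y) (h2 : G.Lr p q y z)
    (h3 : G.Lr p q z t) : G.Lr p q x t := by
  obtain ⟨y', a1, t1⟩ := h1
  obtain ⟨z', a2, t2⟩ := H.twL t1 h2
  obtain ⟨t', a3, t3⟩ := H.twL t2 h3
  obtain ⟨x', a4, t4⟩ := H.H1 a1
  obtain ⟨c, hc, hc'⟩ := G.io a2 a4
  have a5 : G.Ar p x' t' := G.tw hc hc' a3
  exact H.Ltw (H.twL t4 (H.Lof a5)) t3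

theorem Lfwd (H : Hyp G p q) {x y s w : W} (h : G.Lr p q x y) (h1 : G.Ar q y w)
    (h2 : G.Ar q x s) : G.Lr p q s w := by
  obtain ⟨y', a1, t1⟩ := h
  obtain ⟨t, ht, ht'⟩ := G.exch s x y'
  have b : G.Ar q y' t := G.tswap' (ht'.trans (G.tswap h2))
  exact ⟨t, ht.trans a1, Tw.of_in b (t1.symm.out h1)⟩

theorem Lbwd (H : Hyp G p q) {x y s w : W} (h : G.Lr p q s w) (h1 : G.Ar q y w)
    (h2 : G.Ar q x s) : G.Lr p q x y := by
  obtain ⟨w', a1, t1⟩ := h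
  obtain ⟨t, ht, ht'⟩ := G.exch x s w'
  have b : G.Ar q t w' := ht'.trans h2
  exact ⟨t, ht.trans a1, ⟨w, t1.inn b, h1⟩⟩

theorem N (H : Hyp G p q) {u v w : W} (h1 : G.Lr p q u v) (h2 : G.Ar q v w)
    (h3 : G.Lr p q u w) : False := by
  obtain ⟨v', a1, t1⟩ := h1
  obtain ⟨w', a2, t2⟩ := h3
  have b : G.Ar q v' w' := t2.symm.inn (t1.symm.out h2)
  have e := a2.d
  rcases H.bounds a1 b with h | h
  · have : ddist G.adj u w' = 2 := congrArg Prod.fst h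
    omega
  · have : ddist G.adj u w' = 2 := congrArg Prod.fst h
    omega

theorem notTwL (H : Hyp G p q) {x y : W} (h1 : G.Lr p q x y) (h2 : G.Tw q x y) : False := by
  obtain ⟨y', a1, t1⟩ := h1
  obtain ⟨e, he, he'⟩ := h2.trans t1.symm
  exact H.hnot x y' e a1 he he'

theorem BWtw (H : Hyp G p q) (n : ℕ) : ∀ {x y y' : W}, G.BW q n x y → G.BW q n x y' →
    G.Tw q y y' := by
  induction n with
  | zero =>
    intro x y y' h h'
    have h : x = y := h
    have h' : x = y' := h'
    rw [← h, ← h']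
    exact H.rfl' x
  | succ n ih =>
    rintro x y y' ⟨z, hz, b⟩ ⟨z', hz', b'⟩
    exact Tw.of_in ((ih hz hz').out b) b'

theorem BWloop (H : Hyp G p q) {v w : W} (h : G.Ar q v w) : G.BW q q v v := by
  have key : ∀ n k t, ddist G.adj t v = n → ddist G.adj w t ≤ k → n + k + 1 = q →
      G.BW q (k + 1) v t → G.BW q q v v := by
    intro n
    induction n with
    | zero =>
      intro k t h1 h2 h3 h4
      rw [G.deq h1] at h4
      rwa [show q = k + 1 by omega] at h4 ⊢
    | succ n ih =>
      intro k t h1 h2 h3 h4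
      obtain ⟨t', ht, hd⟩ := G.dstep h1
      have e1 := G.tri t t' v
      have e2 := G.tri w t t'
      have e3 := G.adjd ht
      exact ih (k + 1) t' (by omega) (by omega) (by omega) ⟨t, h4, H.P h ht (by omega)⟩
  have := H.q2
  exact key (q - 1) 0 w h.d' (by rw [G.dself]) (by omega) ⟨v, rfl, h⟩

theorem caseD (H : Hyp G p q) {u v w : W} (h1 : G.Ar p u v) (h2 : G.Ar q v w)
    (h3 : tdist G.adj u w = (2, q - 1)) : False := by
  have hq2 := H.q2
  have duv := h1.d
  have dvw := h2.d
  have dwu : ddist G.adj w u = q - 1 := congrArg Prod.snd h3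
  have wk := G.walk_ddist w u
  rw [dwu] at wk
  obtain ⟨f, f0, fn, hf⟩ := wk
  have df : ∀ i j, i ≤ j → j ≤ q - 1 → ddist G.adj (f i) (f j) ≤ j - i := by
    intro i j hij hj
    have := walk_sub hf i (j - i) (by omega)
    rw [show i + (j - i) = j by omega] at this
    exact ddist_le this
  have arcs : ∀ i < q - 1, G.Ar q (f i) (f (i + 1)) ∨ G.Lr p q (f i) (f (i + 1)) := by
    intro i hi
    obtain ⟨z, hz, hz'⟩ := G.exch w (f i) (f (i + 1))
    have e1 : ddist G.adj z (f (i + 1)) = ddist G.adj w (f i) := congrArg Prod.fst hz'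
    have e2 := df 0 i (by omega) (by omega)
    rw [f0] at e2
    have e3 := df (i + 1) (q - 1) (by omega) (by omega)
    rw [fn] at e3
    have e4 := G.tri z (f (i + 1)) u
    have e5 := G.tri z u v
    have e6 : ddist G.adj w z = 1 := (congrArg Prod.fst hz).trans (G.adjd (hf i hi))
    have e7 := G.tri v w z
    by_cases c : ddist G.adj z v ≤ q - 2
    · left
      have : G.Ar q w z := H.P h2 (G.dadj e6) (by rw [G.dself]; omega)
      exact hz.symm.trans this
    · have c' : ddist G.adj z v = q - 1 := by omega
      have c0 : ddist G.adj v z ≠ 0 := by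
        intro h
        have := G.deq h
        subst this
        rw [G.dself] at c'
        omega
      have c1 : ddist G.adj v z ≠ 1 := by
        intro h
        have b : G.Ar q v z := by simp [Ar, tdist, h, c']
        exact H.ne h1 (H.P b h1.adj (by rw [G.dself]; omega))
      have c2 : ddist G.adj v z = 2 := by omega
      have c3 : tdist G.adj v z = tdist G.adj u w := by
        rw [h3]; simp [tdist, c2, c']
      right
      obtain ⟨v', hv, hv'⟩ := G.transfer (z := v) c3
      have a : G.Ar p v v' := hv.trans h1
      have b : G.Ar q v' z := hv'.trans h2
      exact (H.Lfwd (H.Lof a) b h2).cong hz.symm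
  have two : ∀ i j, i < j → j < q - 1 → G.Lr p q (f i) (f (i + 1)) →
      G.Lr p q (f j) (f (j + 1)) → False := by
    intro i j hij hj hi' hj'
    obtain ⟨z, hz, hz'⟩ := G.exch w (f i) (f (i + 1))
    obtain ⟨z2, hz2, hz2'⟩ := G.exch z (f j) (f (j + 1))
    have e1 : ddist G.adj z (f (i + 1)) = ddist G.adj w (f i) := congrArg Prod.fst hz'
    have e2 := df 0 i (by omega) (by omega)
    rw [f0] at e2
    have e3 := df (i + 1) j (by omega) (by omega)
    have e4 := G.tri z (f (i + 1)) (f j)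
    have e5 : ddist G.adj z2 (f (j + 1)) = ddist G.adj z (f j) := congrArg Prod.fst hz2'
    have e6 := df (j + 1) (q - 1) (by omega) (by omega)
    rw [fn] at e6
    have e7 := G.tri z2 (f (j + 1)) u
    obtain ⟨o1, ho1⟩ := G.ex_in H.hq z
    obtain ⟨o, ho⟩ := G.ex_in H.hq z2
    have l1 := H.Lbwd (hi'.cong hz) ho1 h2
    have l2 := H.Lbwd (hj'.cong hz2) ho ho1
    obtain ⟨o', a, t⟩ := H.L3 (H.Lof h1) l1 l2
    have b : G.Ar q o' z2 := t.symm.out ho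
    have e8 := b.d'
    have e9 := a.d
    have e10 := G.tri z2 u o'
    omega
  have st : ∀ k ≤ q - 1, G.BW q (k + 1) v (f k) ∨
      ((∃ i < k, G.Lr p q (f i) (f (i + 1))) ∧ ∃ s, G.BW q k v s ∧ G.Lr p q s (f k)) := by
    intro k
    induction k with
    | zero =>
      intro _
      left
      rw [f0]
      exact ⟨v, rfl, h2⟩
    | succ k ih =>
      intro hk
      rcases ih (by omega) with h | ⟨⟨i, hi, hl⟩, s, hs, hsl⟩
      · rcases arcs k (by omega) with b | l
        · exact Or.inl ⟨f k, h, b⟩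
        · exact Or.inr ⟨⟨k, by omega, l⟩, f k, h, l⟩
      · rcases arcs k (by omega) with b | l
        · obtain ⟨s', hs'⟩ := G.ex_out H.hq s
          exact Or.inr ⟨⟨i, by omega, hl⟩, s', ⟨s, hs, hs'⟩, H.Lfwd hsl b hs'⟩
        · exact (two i k hi (by omega) hl l).elim
  have loop := H.BWloop h2
  rcases st (q - 1) le_rfl with h | ⟨_, s, hs, hl⟩
  · rw [fn, show q - 1 + 1 = q by omega] at h
    exact H.notTwL (H.Lof h1) (H.BWtw q h loop)
  · rw [fn] at hl
    obtain ⟨v3, hv3⟩ := G.ex_out H.hq s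
    have h : G.BW q (q - 1 + 1) v v3 := ⟨s, hs, hv3⟩
    rw [show q - 1 + 1 = q by omega] at h
    have b : G.Ar q s v := (H.BWtw q h loop).inn hv3
    exact H.N (H.Lsymm hl) b (H.Lof h1)

theorem final (H : Hyp G p q) {u v w : W} (h1 : G.Ar p u v) (h2 : G.Ar q v w) :
    tdist G.adj u w = (2, q) :=
  (H.bounds h1 h2).resolve_left (H.caseD h1 h2)

end Hyp
end CTWDR

/-- Lemma 4.2(i): if `q ≠ p`, `Γ_{1,p-1}^2 ∩ Γ_{1,q-1}Γ_{q-1,1} ≠ ∅`,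
`Γ_{1,p-1} ∉ Γ_{1,q-1}Γ_{q-1,1}` and `(1,q-1)` is pure, then
`Γ_{1,p-1}Γ_{1,q-1} = {Γ_{2,q}}`. -/
theorem stmt12 {V : Type*} [Fintype V] (G : CTWDR V) (p q : ℕ) (hpq : q ≠ p)
    (hp : Attained G.adj (1, p - 1)) (hq : Attained G.adj (1, q - 1))
    (hcap : (G.pow (1, p - 1) 2 ∩ G.prodS {(1, q - 1)} {(q - 1, 1)}).Nonempty)
    (hnot : (1, p - 1) ∉ G.prodS {(1, q - 1)} {(q - 1, 1)})
    (hpure : G.Pure q) :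
    G.prodS {(1, p - 1)} {(1, q - 1)} = {(2, q)} := by
  have H : CTWDR.Hyp G p q := by
    refine ⟨hpq, hp, hq, ?_, ?_, hpure⟩
    · obtain ⟨h, ⟨i, hi, j, hj, h1⟩, ⟨i', hi', j', hj', h2⟩⟩ := hcap
      have hi : i = (1, p - 1) := hi
      have hj : j = (1, p - 1) := hj
      have hi' : i' = (1, q - 1) := hi'
      have hj' : j' = (q - 1, 1) := hj'
      subst hi hj hi' hj'
      obtain ⟨x, y, c, e0, e1, e2⟩ := G.pnum_ne h1
      obtain ⟨x', y', c', e0', e1', e2'⟩ := G.pnum_ne h2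
      obtain ⟨z, hz, hz'⟩ := G.transfer (x := x') (y := y') (z := c') (x' := x) (y' := y)
        (e0.trans e0'.symm)
      exact ⟨x, y, c, z, e1, e2, hz.trans e1', G.tswap (hz'.trans e2')⟩
    · intro x y e h1 h2 h3
      apply hnot
      refine ⟨_, rfl, _, rfl, ?_⟩
      rw [← h1]
      exact G.ne_pnum h2 (G.tswap h3)
  ext h
  constructor
  · rintro ⟨i, hi, j, hj, h1⟩
    have hi : i = (1, p - 1) := hi
    have hj : j = (1, q - 1) := hj
    subst hi hj
    obtain ⟨x, y, z, e0, e1, e2⟩ := G.pnum_ne h1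
    have := H.final e1 e2
    rw [e0] at this
    exact this
  · intro hh
    have hh : h = (2, q) := hh
    subst hh
    obtain ⟨u, v, h1⟩ := hp
    obtain ⟨w, h2⟩ := G.ex_out hq v
    refine ⟨_, rfl, _, rfl, ?_⟩
    rw [← H.final h1 h2]
    exact G.ne_pnum h1 h2
end
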